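/- arXiv:2102.07976 — 3 statements merged into one kernel-verified Lean document; each statement's English description precedes it below -/
import Mathlib

section
/- Let X ⊆ ℝⁿ and Y ⊆ ℝᵐ be compact with Y nonempty and convex. Let F, f : ℝⁿ × ℝᵐ → ℝ be such that F, ∇_y F, f, ∇_y f are continuous on X × ℝᵐ, and for every x ∈ X, F(x,·) is convex, L_F-smooth and bounded below by M₀, and f(x,·) is convex and L_f-smooth. Assume that for every x ∈ X the set Ŝ(x) := argmin { F(x,y) : y ∈ Y ∩ S(x) } is nonempty, where S(x) := argmin_{y∈ℝᵐ} f(x,y). Fix y₀ ∈ Y, s_u ∈ (0, 1/L_F), s_l ∈ (0, 1/L_f), μ ∈ (0,1), α_k = 1/(k+1), β_k ∈ [β̲, 1] with β̲ > 0 and |β_k − β_{k−1}| ≤ c_β/(k+1)² for some c_β > 0, and for each x ∈ X define y_{k+1}(x) = Proj_Y( y_k(x) − ( μ α_k s_u ∇_y F(x, y_k(x)) + (1−μ) β_k s_l ∇_y f(x, y_k(x)) ) ) with y₀(x) = y₀. Then, with φ(x) := inf_{y ∈ Y ∩ S(x)} F(x,y) and f*(x) := min_{y∈ℝᵐ} f(x,y):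 (UL) for every x ∈ X, F(x, y_K(x)) → φ(x) as K → ∞; (LL) the family {y_K(x) : K ∈ ℕ, x ∈ X} is bounded, and sup_{x∈X} ( f(x, y_K(x)) − f*(x) ) → 0 as K → ∞. -/
open Filter Topology Set Metric

section Gradient

variable {E : Type*} [NormedAddCommGroup E] [InnerProductSpace ℝ E] [CompleteSpace E]

lemma HasGradientAt.hasDerivAt_lineMap {g : E → ℝ} {g' : E} {a b : E} {t : ℝ}
    (h : HasGradientAt g g' (AffineMap.lineMap a b t)) :
    HasDerivAt (fun s : ℝ => g (AffineMap.lineMap a b s)) (inner ℝ g' (b - a)) t := by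
  have h1 : HasDerivAt (fun s : ℝ => AffineMap.lineMap a b s) (b - a) t :=
    AffineMap.hasDerivAt_lineMap
  have h2 := h.hasFDerivAt.comp_hasDerivAt t h1
  simpa [Function.comp_def] using h2

/-- The first-order characterization of convexity. -/
lemma ConvexOn.add_inner_le_of_hasGradientAt {g : E → ℝ} {g' a : E} (hg : ConvexOn ℝ univ g)
    (h : HasGradientAt g g' a) (u : E) : g a + inner ℝ g' (u - a) ≤ g u := by
  have hd : HasDerivAt (fun s : ℝ => g (AffineMap.lineMap a u s)) (inner ℝ g' (u - a)) 0 :=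
    HasGradientAt.hasDerivAt_lineMap (by simpa using h)
  have hc : ConvexOn ℝ univ (fun s : ℝ => g (AffineMap.lineMap a u s)) :=
    hg.comp_affineMap (AffineMap.lineMap a u)
  have := hc.le_slope_of_hasDerivAt (mem_univ 0) (mem_univ 1) one_pos hd
  simp [slope_def_field] at this
  linarith

/-- The descent lemma for functions with Lipschitz gradient. -/
lemma le_add_inner_add_sq_of_lipschitz_gradient {g : E → ℝ} {g' : E → E} {L : ℝ}
    (h : ∀ w, HasGradientAt g (g' w) w) (hL : ∀ a b, ‖g' a - g' b‖ ≤ L * ‖a - b‖) (a b : E) :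
    g b ≤ g a + inner ℝ (g' a) (b - a) + L / 2 * ‖b - a‖ ^ 2 := by
  have hd : ∀ t : ℝ, HasDerivAt (fun s : ℝ => g (AffineMap.lineMap a b s)
      - s * inner ℝ (g' a) (b - a) - L / 2 * ‖b - a‖ ^ 2 * s ^ 2)
      (inner ℝ (g' (AffineMap.lineMap a b t)) (b - a) - inner ℝ (g' a) (b - a)
        - L / 2 * ‖b - a‖ ^ 2 * (2 * t)) t := by
    intro t
    have h1 := (h (AffineMap.lineMap a b t)).hasDerivAt_lineMap
    have h2 := (hasDerivAt_id t).mul_const (inner ℝ (g' a) (b - a))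
    have h3 := (hasDerivAt_pow 2 t).const_mul (L / 2 * ‖b - a‖ ^ 2)
    simpa using (h1.fun_sub h2).fun_sub h3
  have hanti := antitoneOn_of_deriv_nonpos (convex_Icc (0 : ℝ) 1)
    (fun t _ => (hd t).continuousAt.continuousWithinAt)
    (fun t _ => (hd t).differentiableAt.differentiableWithinAt) (by
      intro t ht
      rw [interior_Icc] at ht
      rw [(hd t).deriv, ← inner_sub_left]
      have h1 := real_inner_le_norm (g' (AffineMap.lineMap a b t) - g' a) (b - a)
      have h2 := hL (AffineMap.lineMap a b t) a
      have h3 : ‖AffineMap.lineMap a b t - a‖ = t * ‖b - a‖ := by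
        rw [AffineMap.lineMap_apply, vsub_eq_sub, vadd_eq_add, add_sub_cancel_right, norm_smul,
          Real.norm_of_nonneg ht.1.le]
      rw [h3] at h2
      have h4 := mul_le_mul_of_nonneg_right h2 (norm_nonneg (b - a))
      nlinarith)
  have := hanti (left_mem_Icc.2 zero_le_one) (right_mem_Icc.2 zero_le_one) zero_le_one
  simp at this
  linarith

/-- The basic inequality for one projected gradient step on `a • F + b • f`. -/
lemma two_mul_add_sq_le_of_projected_gradient_step {Y : Set E} (hY : Convex ℝ Y) {F f : E → ℝ}
    {F' f' : E → E} {LF Lf a b : ℝ} (hF : ∀ w, HasGradientAt F (F' w) w)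
    (hf : ∀ w, HasGradientAt f (f' w) w) (hFc : ConvexOn ℝ univ F) (hfc : ConvexOn ℝ univ f)
    (hLF : ∀ v w, ‖F' v - F' w‖ ≤ LF * ‖v - w‖) (hLf : ∀ v w, ‖f' v - f' w‖ ≤ Lf * ‖v - w‖)
    (ha : 0 ≤ a) (hb : 0 ≤ b) (hab : a * LF + b * Lf ≤ 1) {y p u : E} (hp : p ∈ Y)
    (hnear : ∀ w ∈ Y, ‖y - (a • F' y + b • f' y) - p‖ ≤ ‖y - (a • F' y + b • f' y) - w‖)
    (hu : u ∈ Y) :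
    2 * (a * F p + b * f p) + ‖p - u‖ ^ 2 ≤ 2 * (a * F u + b * f u) + ‖y - u‖ ^ 2 := by
  have : Nonempty Y := ⟨⟨p, hp⟩⟩
  have hvar := (norm_eq_iInf_iff_real_inner_le_zero hY hp).1
    (le_antisymm (le_ciInf fun w => hnear w w.2)
      (ciInf_le ⟨0, by rintro _ ⟨w, rfl⟩; exact norm_nonneg _⟩ (⟨p, hp⟩ : Y))) u hu
  have e : y - (a • F' y + b • f' y) - p = (y - p) - (a • F' y + b • f' y) := by abel
  rw [e, inner_sub_left, inner_add_left, real_inner_smul_left, real_inner_smul_left] at hvar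
  have hsub : ∀ v : E, inner ℝ v (u - p) = inner ℝ v (u - y) - inner ℝ v (p - y) := by
    intro v; rw [← inner_sub_right]; congr 1; abel
  rw [hsub (F' y), hsub (f' y)] at hvar
  have hpol : ‖y - u‖ ^ 2 = ‖y - p‖ ^ 2 - 2 * inner ℝ (y - p) (u - p) + ‖p - u‖ ^ 2 := by
    have : y - u = (y - p) - (u - p) := by abel
    rw [this, norm_sub_sq_real, norm_sub_rev u p]
  have c1 := mul_le_mul_of_nonneg_left (hFc.add_inner_le_of_hasGradientAt (hF y) u) ha
  have c2 := mul_le_mul_of_nonneg_left (hfc.add_inner_le_of_hasGradientAt (hf y) u) hb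
  have d1 := mul_le_mul_of_nonneg_left (le_add_inner_add_sq_of_lipschitz_gradient hF hLF y p) ha
  have d2 := mul_le_mul_of_nonneg_left (le_add_inner_add_sq_of_lipschitz_gradient hf hLf y p) hb
  have hq := mul_le_mul_of_nonneg_right hab (sq_nonneg ‖p - y‖)
  rw [norm_sub_rev y p] at hpol
  linarith

end Gradient

/-- Rate of decay of the lower-level gap `Δ`, driven by the almost monotone quantity
`Δ k + a k / b k * (G k + C)`. -/
lemma natCast_mul_gap_le {a b G Δ D : ℕ → ℝ} {A bl R C ψ : ℝ} (hA : 0 ≤ A) (hbl : 0 < bl)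
    (hR : 0 ≤ R) (ha : ∀ k, 0 ≤ a k) (haA : ∀ k, a k ≤ A / (k + 1)) (hb : ∀ k, bl ≤ b k)
    (hr : ∀ k, |a (k + 1) / b (k + 1) - a k / b k| ≤ R / ((k : ℝ) + 1) ^ 2)
    (hG : ∀ k, |G k| ≤ C) (hψ : |ψ| ≤ C) (hΔ : ∀ k, 0 ≤ Δ k) (hD : ∀ k, 0 ≤ D k)
    (hdesc : ∀ k, a k * G (k + 1) + b k * Δ (k + 1) ≤ a k * G k + b k * Δ k)
    (hstep : ∀ k, 2 * (a k * G (k + 1) + b k * Δ (k + 1)) + D (k + 1) ≤ 2 * (a k * ψ) + D k)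
    (K : ℕ) :
    K * Δ K ≤ D 0 / (2 * bl)
      + (2 * C * R + 2 * C * A / bl + 2 * C * A / bl)
        * ∑ k ∈ Finset.range K, (1 / (k + 1) : ℝ) := by
  have hC : 0 ≤ C := (abs_nonneg _).trans hψ
  have hbpos : ∀ k, 0 < b k := fun k => hbl.trans_le (hb k)
  set V : ℕ → ℝ := fun k => Δ k + a k / b k * (G k + C) with hV
  have hGC : ∀ k, 0 ≤ G k + C ∧ G k + C ≤ 2 * C := fun k => by
    have := abs_le.1 (hG k); constructor <;> linarith
  have hΔV : ∀ k, Δ k ≤ V k := fun k => by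
    have := mul_nonneg (div_nonneg (ha k) (hbpos k).le) (hGC k).1
    simp only [hV]; linarith
  have hrbd : ∀ k, a k / b k ≤ A / bl * (1 / (k + 1)) := fun k => by
    calc a k / b k ≤ (A / (k + 1)) / bl :=
          div_le_div₀ (by positivity) (haA k) hbl (hb k)
      _ = _ := by field_simp
  have hmono : ∀ k, V (k + 1) ≤ V k + 2 * C * (R / ((k : ℝ) + 1) ^ 2) := fun k => by
    have h1 : Δ (k + 1) + a k / b k * G (k + 1) ≤ Δ k + a k / b k * G k := by
      have hne := (hbpos k).ne'
      have e : ∀ s t, b k * (s + a k / b k * t) = a k * t + b k * s := by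
        intro s t; field_simp; ring
      refine le_of_mul_le_mul_left ?_ (hbpos k)
      rw [e, e]
      exact hdesc k
    have h2 : (a (k + 1) / b (k + 1) - a k / b k) * (G (k + 1) + C)
        ≤ R / ((k : ℝ) + 1) ^ 2 * (2 * C) :=
      mul_le_mul ((le_abs_self _).trans (hr k)) (hGC _).2 (hGC _).1 (by positivity)
    simp only [hV]
    linarith
  have hgap : ∀ k, Δ (k + 1) + D (k + 1) / (2 * bl)
      ≤ D k / (2 * bl) + 2 * C * A / bl * (1 / (k + 1)) := fun k => by
    have h1 : bl * Δ (k + 1) ≤ b k * Δ (k + 1) := mul_le_mul_of_nonneg_right (hb k) (hΔ _)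
    have h2 : a k * (ψ - G (k + 1)) ≤ A / (k + 1) * (2 * C) := by
      have h3 := (abs_le.1 hψ).2
      have h4 := (abs_le.1 (hG (k + 1))).1
      exact (mul_le_mul_of_nonneg_left (by linarith) (ha k)).trans
        (mul_le_mul_of_nonneg_right (haA k) (by linarith))
    have h5 : 2 * bl * Δ (k + 1) + D (k + 1) ≤ D k + 2 * (A / (k + 1) * (2 * C)) := by
      linarith [hstep k]
    have h6 := div_le_div_of_nonneg_right h5 (by positivity : (0 : ℝ) ≤ 2 * bl)
    calc Δ (k + 1) + D (k + 1) / (2 * bl) = (2 * bl * Δ (k + 1) + D (k + 1)) / (2 * bl) := by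
          field_simp
      _ ≤ _ := h6
      _ = _ := by field_simp
  have hmain : ∀ K : ℕ, K * V K + D K / (2 * bl) ≤ D 0 / (2 * bl)
      + (2 * C * R + 2 * C * A / bl + 2 * C * A / bl)
        * ∑ k ∈ Finset.range K, (1 / (k + 1) : ℝ) := by
    intro K
    induction K with
    | zero => simp
    | succ k ih =>
      rw [Finset.sum_range_succ, mul_add]
      push_cast
      have hk : (0 : ℝ) ≤ k := Nat.cast_nonneg k
      have h1 : (k : ℝ) * V (k + 1) ≤ k * V k + 2 * C * R * (1 / (k + 1)) := by
        have h2 := mul_le_mul_of_nonneg_left (hmono k) hk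
        have h3 : (k : ℝ) * (2 * C * (R / ((k : ℝ) + 1) ^ 2)) ≤ 2 * C * R * (1 / (k + 1)) := by
          calc (k : ℝ) * (2 * C * (R / ((k : ℝ) + 1) ^ 2))
              ≤ (k + 1) * (2 * C * (R / ((k : ℝ) + 1) ^ 2)) :=
                mul_le_mul_of_nonneg_right (by linarith) (by positivity)
            _ = _ := by field_simp
        linarith
      have h4 : a (k + 1) / b (k + 1) * (G (k + 1) + C) ≤ 2 * C * A / bl * (1 / (k + 1)) := by
        have h5 : a (k + 1) / b (k + 1) ≤ A / bl * (1 / (k + 1)) := by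
          refine (hrbd (k + 1)).trans (mul_le_mul_of_nonneg_left ?_ (by positivity))
          apply one_div_le_one_div_of_le (by positivity)
          push_cast; linarith
        calc a (k + 1) / b (k + 1) * (G (k + 1) + C) ≤ A / bl * (1 / (k + 1)) * (2 * C) :=
              mul_le_mul h5 (hGC _).2 (hGC _).1 (by positivity)
          _ = _ := by ring
      have h6 := hgap k
      have h7 : V (k + 1) = Δ (k + 1) + a (k + 1) / b (k + 1) * (G (k + 1) + C) := rfl
      linarith
  have h1 := hmain K
  have h2 := mul_le_mul_of_nonneg_left (hΔV K) (Nat.cast_nonneg (α := ℝ) K)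
  have h3 : 0 ≤ D K / (2 * bl) := div_nonneg (hD K) (by positivity)
  linarith

/-- Ratio of the step sizes `A / (k + 1)` and `B * β k` when `β` varies slowly. -/
lemma abs_stepsize_ratio_sub_le {β : ℕ → ℝ} {A B βlow c : ℝ} (hA : 0 ≤ A) (hB : 0 < B)
    (hβlow : 0 < βlow) (hβ : ∀ k, β k ∈ Icc βlow 1)
    (hβdiff : ∀ k ≥ 1, |β k - β (k - 1)| ≤ c / ((k : ℝ) + 1) ^ 2) (hc : 0 ≤ c) (k : ℕ) :
    |A / (((k + 1 : ℕ) : ℝ) + 1) / (B * β (k + 1)) - A / ((k : ℝ) + 1) / (B * β k)|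
      ≤ A / B * (c + 1) / βlow ^ 2 / ((k : ℝ) + 1) ^ 2 := by
  have h0 := hβ k
  have h1 := hβ (k + 1)
  have hp0 : 0 < β k := hβlow.trans_le h0.1
  have hp1 : 0 < β (k + 1) := hβlow.trans_le h1.1
  have hk : (0 : ℝ) < (k : ℝ) + 1 := by positivity
  have hd := hβdiff (k + 1) (by omega)
  simp only [Nat.add_sub_cancel] at hd
  push_cast at hd ⊢
  have e : A / ((k : ℝ) + 1 + 1) / (B * β (k + 1)) - A / ((k : ℝ) + 1) / (B * β k)
      = A / B * (-(((k : ℝ) + 1) * (β (k + 1) - β k) + β (k + 1))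
        / ((β k * β (k + 1)) * (((k : ℝ) + 1) * ((k : ℝ) + 1 + 1)))) := by
    field_simp
    ring
  rw [e, abs_mul, abs_of_nonneg (by positivity : 0 ≤ A / B), abs_div, abs_neg,
    abs_of_pos (by positivity : 0 < (β k * β (k + 1)) * (((k : ℝ) + 1) * ((k : ℝ) + 1 + 1))),
    mul_div_assoc, mul_div_assoc, div_div]
  refine mul_le_mul_of_nonneg_left ?_ (by positivity)
  have hnum : |((k : ℝ) + 1) * (β (k + 1) - β k) + β (k + 1)| ≤ c + 1 := by
    refine (abs_add_le _ _).trans (add_le_add ?_ ?_)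
    · rw [abs_mul, abs_of_pos hk]
      calc ((k : ℝ) + 1) * |β (k + 1) - β k| ≤ (k + 1) * (c / ((k : ℝ) + 1 + 1) ^ 2) :=
            mul_le_mul_of_nonneg_left hd hk.le
        _ ≤ c := by
            rw [← mul_div_assoc, div_le_iff₀ (by positivity), mul_comm]
            exact mul_le_mul_of_nonneg_left (by nlinarith) hc
    · rw [abs_of_pos hp1]; exact h1.2
  refine div_le_div₀ (by positivity) hnum (by positivity) (mul_le_mul ?_ ?_ (by positivity)
    (by positivity))
  · rw [sq]; exact mul_le_mul h0.1 h1.1 hβlow.le hp0.le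
  · rw [sq]; exact mul_le_mul_of_nonneg_left (by linarith) hk.le

/-- If the iterates satisfy the upper-level step inequality and their lower-level gap vanishes, then
the upper-level values converge to the optimal value of the simple bilevel problem. -/
lemma tendsto_of_lower_gap_tendsto {E : Type*} [NormedAddCommGroup E] {Y : Set E}
    (hY : IsCompact Y) {F f : E → ℝ} (hF : ContinuousOn F Y) (hf : ContinuousOn f Y)
    {fmin ψ : ℝ} {w₀ : E} (hw₀ : w₀ ∈ Y) (hfw₀ : f w₀ = fmin) (hFw₀ : F w₀ = ψ)
    (hmin : ∀ w ∈ Y, f w ≤ fmin → ψ ≤ F w)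
    {a : ℕ → ℝ} (ha : ∀ k, 0 ≤ a k)
    (hasum : Tendsto (fun n => ∑ k ∈ Finset.range n, a k) atTop atTop)
    {y : ℕ → E} (hy : ∀ k, y k ∈ Y)
    (hstep : ∀ k, ∀ u ∈ Y, f u ≤ fmin → F u ≤ ψ →
      2 * (a k * (F (y (k + 1)) - ψ)) + ‖y (k + 1) - u‖ ^ 2 ≤ ‖y k - u‖ ^ 2)
    (hgap : ∀ ε > 0, ∀ᶠ k in atTop, f (y k) - fmin < ε) :
    Tendsto (fun k => F (y k)) atTop (𝓝 ψ) := by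
  set g : E → ℝ := fun w => max (f w - fmin) (F w - ψ) with hg
  have hgc : ContinuousOn g Y := (hf.sub continuousOn_const).sup (hF.sub continuousOn_const)
  set S : Set E := {w ∈ Y | g w ≤ 0} with hS
  have hSmem : ∀ {w}, w ∈ S ↔ w ∈ Y ∧ f w ≤ fmin ∧ F w ≤ ψ := by
    intro w
    simp only [hS, hg, mem_ofPred_eq, max_le_iff, sub_nonpos]
  have hSc : IsCompact S := by
    have : S = Y ∩ g ⁻¹' Iic 0 := rfl
    rw [this]
    exact hY.of_isClosed_subset (hgc.preimage_isClosed_of_isClosed hY.isClosed isClosed_Iic)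
      inter_subset_left
  have hSne : S.Nonempty := ⟨w₀, hSmem.2 ⟨hw₀, hfw₀.le, hFw₀.le⟩⟩
  have hdist : ∀ k, 2 * (a k * (F (y (k + 1)) - ψ)) + infDist (y (k + 1)) S ^ 2
      ≤ infDist (y k) S ^ 2 := by
    intro k
    obtain ⟨u, hu, hue⟩ := hSc.exists_infDist_eq_dist hSne (y k)
    obtain ⟨huY, huf, huF⟩ := hSmem.1 hu
    have h1 := hstep k u huY huf huF
    have h2 : infDist (y (k + 1)) S ≤ ‖y (k + 1) - u‖ := by
      rw [← dist_eq_norm]; exact infDist_le_dist_of_mem hu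
    have h3 := pow_le_pow_left₀ infDist_nonneg h2 2
    rw [hue, dist_eq_norm]
    linarith
  have hev : ∀ δ > 0, ∀ᶠ k in atTop, infDist (y k) S < δ := by
    intro δ hδ
    have hT : IsCompact (Y ∩ {w | δ ≤ infDist w S}) :=
      hY.inter_right (isClosed_le continuous_const (continuous_infDist_pt S))
    obtain ⟨ε, hε, hle⟩ := hT.exists_forall_le' (hgc.mono inter_subset_left) (a := 0) (by
      intro w hw
      by_contra! hneg
      have : infDist w S = 0 := infDist_zero_of_mem ⟨hw.1, hneg⟩
      have := hw.2
      simp only [mem_ofPred_eq] at this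
      linarith)
    obtain ⟨N, hN⟩ := eventually_atTop.1 (hgap ε hε)
    have hfar : ∀ k ≥ N, δ ≤ infDist (y k) S → ε ≤ F (y k) - ψ := by
      intro k hk hd
      rcases le_max_iff.1 (hle (y k) ⟨hy k, hd⟩) with h | h
      · exact absurd (hN k hk) (not_lt.2 h)
      · exact h
    obtain ⟨M, hMN, hM⟩ : ∃ M ≥ N, infDist (y M) S < δ := by
      by_contra! hcon
      have hind : ∀ n, infDist (y (N + n)) S ^ 2
          + 2 * ε * (∑ k ∈ Finset.range (N + n), a k - ∑ k ∈ Finset.range N, a k)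
          ≤ infDist (y N) S ^ 2 := by
        intro n
        induction n with
        | zero => simp
        | succ n ih =>
          rw [← add_assoc, Finset.sum_range_succ]
          have h1 := hdist (N + n)
          have h2 := mul_le_mul_of_nonneg_left
            (hfar (N + n + 1) (by omega) (hcon _ (by omega))) (ha (N + n))
          linarith
      obtain ⟨n, hn⟩ := ((tendsto_atTop.1 hasum) (infDist (y N) S ^ 2 / (2 * ε)
        + ∑ k ∈ Finset.range N, a k + 1)).and (eventually_ge_atTop N) |>.exists
      obtain ⟨j, rfl⟩ := Nat.exists_eq_add_of_le hn.2
      have h1 := hind j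
      have h2 : infDist (y N) S ^ 2 / (2 * ε) + 1
          ≤ ∑ k ∈ Finset.range (N + j), a k - ∑ k ∈ Finset.range N, a k := by linarith [hn.1]
      have h3 := mul_le_mul_of_nonneg_left h2 (by positivity : 0 ≤ 2 * ε)
      rw [mul_add, mul_div_cancel₀ _ (by positivity : 2 * ε ≠ 0)] at h3
      nlinarith [sq_nonneg (infDist (y (N + j)) S)]
    refine eventually_atTop.2 ⟨M, fun k hk => ?_⟩
    induction k, hk using Nat.le_induction with
    | base => exact hM
    | succ k hk ih =>
      by_contra! hcon
      have h1 := hdist k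
      have h2 := mul_nonneg (ha k) (hε.le.trans (hfar (k + 1) (by omega) hcon))
      have h3 : infDist (y (k + 1)) S ≤ infDist (y k) S :=
        le_of_sq_le_sq (by linarith) infDist_nonneg
      linarith
  rw [Metric.tendsto_atTop']
  intro ε hε
  have hT : IsCompact (Y ∩ (fun w => |F w - ψ|) ⁻¹' Ici ε) :=
    hY.of_isClosed_subset (((hF.sub continuousOn_const).abs).preimage_isClosed_of_isClosed
      hY.isClosed isClosed_Ici) inter_subset_left
  obtain ⟨δ, hδ, hle⟩ := hT.exists_forall_le' (continuous_infDist_pt S).continuousOn (a := 0) (by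
    intro w hw
    refine (hSc.isClosed.notMem_iff_infDist_pos hSne).1 fun hwS => ?_
    obtain ⟨hwY, hwf, hwF⟩ := hSmem.1 hwS
    have h1 : F w = ψ := le_antisymm hwF (hmin w hwY hwf)
    have h2 : ε ≤ |F w - ψ| := hw.2
    rw [h1, sub_self, abs_zero] at h2
    linarith)
  obtain ⟨N, hN⟩ := eventually_atTop.1 (hev δ hδ)
  refine ⟨N, fun k hk => ?_⟩
  rw [Real.dist_eq]
  by_contra! hcon
  exact absurd (hN k hk.le) (not_lt.2 (hle _ ⟨hy k, hcon⟩))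

theorem stmt8 {n m : ℕ}
    (X : Set (EuclideanSpace ℝ (Fin n))) (Y : Set (EuclideanSpace ℝ (Fin m)))
    (hX : IsCompact X) (hYne : Y.Nonempty) (hYcpt : IsCompact Y) (hYconv : Convex ℝ Y)
    (F f : EuclideanSpace ℝ (Fin n) → EuclideanSpace ℝ (Fin m) → ℝ)
    (Fy fy : EuclideanSpace ℝ (Fin n) → EuclideanSpace ℝ (Fin m) → EuclideanSpace ℝ (Fin m))
    (hFgrad : ∀ x w, HasGradientAt (F x) (Fy x w) w)
    (hfgrad : ∀ x w, HasGradientAt (f x) (fy x w) w)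
    (hFc : ContinuousOn (fun p : EuclideanSpace ℝ (Fin n) × EuclideanSpace ℝ (Fin m) => F p.1 p.2) (X ×ˢ univ))
    (hfc : ContinuousOn (fun p : EuclideanSpace ℝ (Fin n) × EuclideanSpace ℝ (Fin m) => f p.1 p.2) (X ×ˢ univ))
    (hFyc : ContinuousOn (fun p : EuclideanSpace ℝ (Fin n) × EuclideanSpace ℝ (Fin m) => Fy p.1 p.2) (X ×ˢ univ))
    (hfyc : ContinuousOn (fun p : EuclideanSpace ℝ (Fin n) × EuclideanSpace ℝ (Fin m) => fy p.1 p.2) (X ×ˢ univ))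
    (LF Lf M₀ : ℝ)
    (hFconv : ∀ x ∈ X, ConvexOn ℝ univ (F x))
    (hFlip : ∀ x ∈ X, ∀ a b, ‖Fy x a - Fy x b‖ ≤ LF * ‖a - b‖)
    (hFbdd : ∀ x ∈ X, ∀ w, M₀ ≤ F x w)
    (hfconv : ∀ x ∈ X, ConvexOn ℝ univ (f x))
    (hflip : ∀ x ∈ X, ∀ a b, ‖fy x a - fy x b‖ ≤ Lf * ‖a - b‖)
    (S : EuclideanSpace ℝ (Fin n) → Set (EuclideanSpace ℝ (Fin m)))
    (hS : ∀ x, S x = {w : EuclideanSpace ℝ (Fin m) | ∀ w', f x w ≤ f x w'})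
    (φ : EuclideanSpace ℝ (Fin n) → ℝ) (hφ : ∀ x, φ x = sInf (F x '' (Y ∩ S x)))
    (fstar : EuclideanSpace ℝ (Fin n) → ℝ) (hfstar : ∀ x, fstar x = ⨅ w, f x w)
    -- nonemptiness of Ŝ(x) = argmin of F(x,·) over Y ∩ S(x)
    (hShat : ∀ x ∈ X, ∃ w ∈ Y ∩ S x, ∀ w' ∈ Y ∩ S x, F x w ≤ F x w')
    (su sl μ : ℝ)
    (hsu : su ∈ Ioo 0 (1 / LF)) (hsl : sl ∈ Ioo 0 (1 / Lf)) (hμ : μ ∈ Ioo (0 : ℝ) 1)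
    (α : ℕ → ℝ) (hα : ∀ k, α k = 1 / ((k : ℝ) + 1))
    (βlow cβ : ℝ) (hβlow : 0 < βlow) (hcβ : 0 < cβ)
    (β : ℕ → ℝ) (hβ : ∀ k, β k ∈ Icc βlow 1)
    (hβdiff : ∀ k ≥ 1, |β k - β (k - 1)| ≤ cβ / ((k : ℝ) + 1) ^ 2)
    (proj : EuclideanSpace ℝ (Fin m) → EuclideanSpace ℝ (Fin m))
    (hprojY : ∀ z, proj z ∈ Y)
    (hprojnear : ∀ z, ∀ w ∈ Y, ‖z - proj z‖ ≤ ‖z - w‖)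
    (y₀ : EuclideanSpace ℝ (Fin m)) (hy₀ : y₀ ∈ Y)
    (y : ℕ → EuclideanSpace ℝ (Fin n) → EuclideanSpace ℝ (Fin m))
    (hy0 : ∀ x, y 0 x = y₀)
    (hyrec : ∀ k x, y (k + 1) x =
      proj (y k x - ((μ * α k * su) • Fy x (y k x) + ((1 - μ) * β k * sl) • fy x (y k x)))) :
    -- (UL) objective convergence property
    (∀ x ∈ X, Tendsto (fun K => F x (y K x)) atTop (𝓝 (φ x))) ∧
    -- (LL) objective convergence property
    (∃ C : ℝ, ∀ K, ∀ x ∈ X, ‖y K x‖ ≤ C) ∧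
    (∀ ε > (0 : ℝ), ∃ N : ℕ, ∀ K ≥ N, ∀ x ∈ X, f x (y K x) - fstar x ≤ ε) := by
  obtain ⟨hsu0, hsu1⟩ := hsu
  obtain ⟨hsl0, hsl1⟩ := hsl
  obtain ⟨hμ0, hμ1⟩ := hμ
  have hLF : 0 < LF := one_div_pos.1 (hsu0.trans hsu1)
  have hLf : 0 < Lf := one_div_pos.1 (hsl0.trans hsl1)
  rw [lt_div_iff₀ hLF] at hsu1
  rw [lt_div_iff₀ hLf] at hsl1
  have hμ1' : 0 < 1 - μ := sub_pos.2 hμ1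
  have hA : 0 < μ * su := mul_pos hμ0 hsu0
  have hB : 0 < (1 - μ) * sl := mul_pos hμ1' hsl0
  have haeq : ∀ k, μ * α k * su = μ * su / ((k : ℝ) + 1) := fun k => by rw [hα]; ring
  have hbeq : ∀ k, (1 - μ) * β k * sl = (1 - μ) * sl * β k := fun k => by ring
  have ha : ∀ k, 0 ≤ μ * α k * su := fun k => by rw [haeq]; positivity
  have hb : ∀ k, (1 - μ) * sl * βlow ≤ (1 - μ) * β k * sl := fun k => by
    rw [hbeq]; exact mul_le_mul_of_nonneg_left (hβ k).1 hB.le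
  have hbl : 0 < (1 - μ) * sl * βlow := mul_pos hB hβlow
  have hab : ∀ k, μ * α k * su * LF + (1 - μ) * β k * sl * Lf ≤ 1 := fun k => by
    have h1 : μ * α k * su * LF ≤ μ := by
      have hα1 : α k ≤ 1 := by
        rw [hα, div_le_one (by positivity)]; linarith [Nat.cast_nonneg (α := ℝ) k]
      have hα0 : 0 ≤ α k := by rw [hα]; positivity
      calc μ * α k * su * LF = μ * (α k * (su * LF)) := by ring
        _ ≤ μ * 1 := mul_le_mul_of_nonneg_left (mul_le_one₀ hα1 (by positivity) hsu1.le) hμ0.le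
        _ = μ := mul_one μ
    have h2 : (1 - μ) * β k * sl * Lf ≤ 1 - μ := by
      calc (1 - μ) * β k * sl * Lf = (1 - μ) * (β k * (sl * Lf)) := by ring
        _ ≤ (1 - μ) * 1 := mul_le_mul_of_nonneg_left
          (mul_le_one₀ (hβ k).2 (by positivity) hsl1.le) hμ1'.le
        _ = 1 - μ := mul_one _
    linarith
  have hyY : ∀ k x, y k x ∈ Y := by
    rintro (_ | k) x
    · rw [hy0]; exact hy₀
    · rw [hyrec]; exact hprojY _
  have hstep : ∀ x ∈ X, ∀ k, ∀ u ∈ Y,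
      2 * (μ * α k * su * F x (y (k + 1) x) + (1 - μ) * β k * sl * f x (y (k + 1) x))
        + ‖y (k + 1) x - u‖ ^ 2
      ≤ 2 * (μ * α k * su * F x u + (1 - μ) * β k * sl * f x u) + ‖y k x - u‖ ^ 2 := by
    intro x hx k u hu
    refine two_mul_add_sq_le_of_projected_gradient_step hYconv (hFgrad x) (hfgrad x)
      (hFconv x hx) (hfconv x hx) (hFlip x hx) (hflip x hx) (ha k) (hbl.le.trans (hb k)) (hab k)
      (hyY (k + 1) x) (fun w hw => ?_) hu
    rw [hyrec]
    exact hprojnear _ w hw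
  obtain ⟨C, hC⟩ := (hX.prod hYcpt).exists_bound_of_continuousOn
    (hFc.mono (prod_mono_right (subset_univ Y)))
  obtain ⟨CY, hCY⟩ := hYcpt.isBounded.exists_norm_le
  have hmin : ∀ x ∈ X, ∃ u ∈ Y, f x u = fstar x ∧ F x u = φ x ∧ (∀ w, fstar x ≤ f x w) ∧
      ∀ w ∈ Y, f x w ≤ fstar x → φ x ≤ F x w := by
    intro x hx
    obtain ⟨u, ⟨huY, huS⟩, hu⟩ := hShat x hx
    have huS' := huS
    rw [hS] at huS'
    have h1 : f x u = fstar x := by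
      rw [hfstar]
      exact le_antisymm (le_ciInf huS') (ciInf_le ⟨f x u, by rintro _ ⟨w, rfl⟩; exact huS' w⟩ u)
    have h2 : F x u = φ x := by
      rw [hφ]
      have hleast : IsLeast (F x '' (Y ∩ S x)) (F x u) := by
        refine ⟨⟨u, ⟨huY, huS⟩, rfl⟩, ?_⟩
        rintro _ ⟨w, hw, rfl⟩
        exact hu w hw
      exact hleast.csInf_eq.symm
    refine ⟨u, huY, h1, h2, fun w => h1 ▸ huS' w, fun w hw hfw => h2 ▸ hu w ⟨hw, ?_⟩⟩
    rw [hS]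
    exact fun w' => hfw.trans (h1 ▸ huS' w')
  have hrate : ∃ E Q : ℝ, ∀ x ∈ X, ∀ K : ℕ, K * (f x (y K x) - fstar x)
      ≤ E + Q * ∑ k ∈ Finset.range K, (1 / (k + 1) : ℝ) := by
    refine ⟨(CY + CY) ^ 2 / (2 * ((1 - μ) * sl * βlow)),
      2 * C * (μ * su / ((1 - μ) * sl) * (cβ + 1) / βlow ^ 2)
        + 2 * C * (μ * su) / ((1 - μ) * sl * βlow) + 2 * C * (μ * su) / ((1 - μ) * sl * βlow),
      fun x hx K => ?_⟩
    obtain ⟨u, huY, hfu, hFu, hle, -⟩ := hmin x hx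
    have hFC : ∀ w ∈ Y, |F x w| ≤ C := fun w hw => hC (x, w) ⟨hx, hw⟩
    refine (natCast_mul_gap_le (a := fun k => μ * α k * su) (b := fun k => (1 - μ) * β k * sl)
      (G := fun k => F x (y k x)) (Δ := fun k => f x (y k x) - fstar x)
      (D := fun k => ‖y k x - u‖ ^ 2) (A := μ * su) (bl := (1 - μ) * sl * βlow)
      (R := μ * su / ((1 - μ) * sl) * (cβ + 1) / βlow ^ 2) (C := C) (ψ := φ x)
      hA.le hbl (by positivity) ha (fun k => (haeq k).le) hb (fun k => ?_)
      (fun k => hFC _ (hyY k x)) (hFu ▸ hFC u huY) (fun k => sub_nonneg.2 (hle _))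
      (fun k => sq_nonneg _) (fun k => ?_) (fun k => ?_) K).trans ?_
    · simp only [haeq, hbeq]
      exact abs_stepsize_ratio_sub_le hA.le hB hβlow hβ hβdiff hcβ.le k
    · have h1 := hstep x hx k (y k x) (hyY k x)
      rw [sub_self, norm_zero] at h1
      nlinarith [sq_nonneg ‖y (k + 1) x - y k x‖]
    · have h1 := hstep x hx k u huY
      rw [hfu, hFu] at h1
      linarith
    · refine add_le_add ?_ le_rfl
      refine div_le_div_of_nonneg_right (pow_le_pow_left₀ (norm_nonneg _) ?_ 2) (by positivity)
      exact (norm_sub_le _ _).trans (add_le_add (hCY _ (hyY 0 x)) (hCY u huY))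
  have hLL : ∀ ε > (0 : ℝ), ∃ N : ℕ, ∀ K ≥ N, ∀ x ∈ X, f x (y K x) - fstar x ≤ ε := by
    intro ε hε
    obtain ⟨E, Q, hEQ⟩ := hrate
    have hlim : Tendsto (fun K : ℕ => E * (K : ℝ)⁻¹
        + Q * ((K : ℝ)⁻¹ * ∑ k ∈ Finset.range K, (1 / (k + 1) : ℝ))) atTop (𝓝 0) := by
      have h1 := (tendsto_inv_atTop_nhds_zero_nat (𝕜 := ℝ)).const_mul E
      have h2 := (tendsto_one_div_add_atTop_nhds_zero_nat (𝕜 := ℝ)).cesaro.const_mul Q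
      simpa using h1.add h2
    obtain ⟨N, hN⟩ := eventually_atTop.1 (hlim.eventually (gt_mem_nhds hε))
    refine ⟨N + 1, fun K hK x hx => ?_⟩
    have hKpos : (0 : ℝ) < K := by exact_mod_cast (by omega : 0 < K)
    have h1 := mul_le_mul_of_nonneg_left (hEQ x hx K) (inv_pos.2 hKpos).le
    rw [inv_mul_cancel_left₀ hKpos.ne'] at h1
    linarith [hN K (by omega)]
  refine ⟨fun x hx => ?_, ⟨CY, fun K x _ => hCY _ (hyY K x)⟩, hLL⟩
  obtain ⟨u, huY, hfu, hFu, hle, hφle⟩ := hmin x hx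
  have hslice : ∀ {g : EuclideanSpace ℝ (Fin m) → ℝ}
      {g' : EuclideanSpace ℝ (Fin m) → EuclideanSpace ℝ (Fin m)},
      (∀ w, HasGradientAt g (g' w) w) → ContinuousOn g Y :=
    fun h w _ => (h w).continuousAt.continuousWithinAt
  refine tendsto_of_lower_gap_tendsto hYcpt (hslice (hFgrad x)) (hslice (hfgrad x)) huY hfu hFu
    hφle ha ?_ (fun k => hyY k x) (fun k v hv hfv hFv => ?_) (fun ε hε => ?_)
  · simp only [haeq, div_eq_mul_one_div (μ * su), ← Finset.mul_sum]
    exact Real.tendsto_sum_range_one_div_nat_succ_atTop.const_mul_atTop hA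
  · have h1 := hstep x hx k v hv
    have h2 := mul_le_mul_of_nonneg_left hFv (ha k)
    have h3 := mul_le_mul_of_nonneg_left (hfv.trans (hle (y (k + 1) x))) (hbl.le.trans (hb k))
    linarith
  · obtain ⟨N, hN⟩ := hLL (ε / 2) (half_pos hε)
    exact eventually_atTop.2 ⟨N, fun k hk => by linarith [hN k hk x hx]⟩
end

section
/- Let X ⊆ ℝⁿ be compact, and let F, f : ℝⁿ × ℝᵐ → ℝ be twice continuously differentiable with: for every x, F(x,·) convex, L_F-smooth and bounded below, and f(x,·) σ-strongly convex (σ > 0) and L_f-smooth; assume f is level-bounded in y uniformly in x ∈ X, i.e. for every r ∈ ℝ the set { y : ∃ x ∈ X, f(x,y) ≤ r } is bounded. Let y*(x) denote the unique minimizer of f(x,·) over ℝᵐ. Fix y₀ ∈ ℝᵐ, s ∈ (0, 1/max(L_F, L_f)), μ ∈ (0,1), a positive nonincreasing sequence α_k with α_k → 0, and a nonincreasing sequence β_k ∈ [β̲, 1] (β̲ > 0) with |β_k − β_{k−1}| ≤ c_β/(k+1)² for some c_β > 0, and define y_{k+1}(x) = y_k(x) − s( α_k μ ∇_y F(x, y_k(x))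 + β_k (1−μ) ∇_y f(x, y_k(x)) ) with y₀(x) = y₀. Set φ_k(x) := F(x, y_k(x)) and φ(x) := F(x, y*(x)) (both differentiable in x, with gradients ∇φ_k, ∇φ). Then sup_{x∈X} ‖∇φ_k(x) − ∇φ(x)‖ → 0 as k → ∞. -/
open Filter Topology Set Metric

section UniformConvergence

/-- A family of nonnegative sequences that contracts by a fixed factor up to a perturbation which is
uniformly negligible relative to `1 + e` tends to zero uniformly. -/
theorem tendsto_zero_of_le_mul_add {ι : Type*} {S : Set ι} {e c : ℕ → ι → ℝ} {ρ : ℝ}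
    (hρ0 : 0 ≤ ρ) (hρ1 : ρ < 1) (he : ∀ k x, 0 ≤ e k x) (hb : ∀ k, BddAbove (e k '' S))
    (hc : Tendsto (fun p : ℕ × ι => c p.1 p.2) (atTop ×ˢ 𝓟 S) (𝓝 0))
    (hstep : ∀ k, ∀ x ∈ S, e (k + 1) x ≤ ρ * e k x + c k x * (1 + e k x)) :
    Tendsto (fun p : ℕ × ι => e p.1 p.2) (atTop ×ˢ 𝓟 S) (𝓝 0) := by
  rw [Metric.tendsto_nhds]
  intro ε hε
  obtain ⟨q, hq0, hq1, hqε⟩ : ∃ q : ℝ, 0 < q ∧ q ≤ 1 ∧ q ≤ ε / 2 :=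
    ⟨min 1 (ε / 2), by positivity, min_le_left _ _, min_le_right _ _⟩
  have hη : 0 < (1 - ρ) / 2 * q := mul_pos (by linarith) hq0
  have hcη := (tendsto_order.1 hc).2 _ hη
  obtain ⟨N, hN⟩ := eventually_atTop.1 (eventually_prod_principal_iff.1 hcη)
  obtain ⟨B, hB⟩ := hb N
  have key : ∀ j, ∀ x ∈ S, e (N + j) x ≤ ((1 + ρ) / 2) ^ j * B + q := by
    intro j
    induction j with
    | zero =>
      intro x hx
      have := hB (mem_image_of_mem _ hx)
      simp only [add_zero, pow_zero, one_mul]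
      linarith
    | succ j ih =>
      intro x hx
      have h1 := hstep (N + j) x hx
      have h2 : c (N + j) x < (1 - ρ) / 2 * q := hN (N + j) (Nat.le_add_right _ _) x hx
      have h3 := he (N + j) x
      have h4 : c (N + j) x * (1 + e (N + j) x) ≤ (1 - ρ) / 2 * q * (1 + e (N + j) x) := by
        gcongr
      have h5 : (1 - ρ) / 2 * q * e (N + j) x ≤ (1 - ρ) / 2 * e (N + j) x := by
        apply mul_le_mul_of_nonneg_right _ h3
        nlinarith
      have h6 : (1 + ρ) / 2 * e (N + j) x ≤ (1 + ρ) / 2 * (((1 + ρ) / 2) ^ j * B + q) :=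
        mul_le_mul_of_nonneg_left (ih x hx) (by linarith)
      rw [← add_assoc, pow_succ]
      linarith
  have hpow : Tendsto (fun j => ((1 + ρ) / 2) ^ j * B) atTop (𝓝 0) := by
    simpa using (tendsto_pow_atTop_nhds_zero_of_lt_one (r := (1 + ρ) / 2) (by linarith)
      (by linarith)).mul_const B
  obtain ⟨J, hJ⟩ := eventually_atTop.1 ((tendsto_order.1 hpow).2 (ε / 2) (by linarith))
  refine eventually_prod_principal_iff.2 (eventually_atTop.2 ⟨N + J, fun k hk x hx => ?_⟩)
  obtain ⟨j, rfl⟩ := Nat.exists_eq_add_of_le (show N ≤ k by omega)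
  have h1 := key j x hx
  have h2 := hJ j (by omega)
  rw [Real.dist_eq, sub_zero, abs_of_nonneg (he _ _)]
  linarith

variable {E W V : Type*} [NormedAddCommGroup E] [NormedAddCommGroup W] [NormedAddCommGroup V]

/-- Composition with a continuous map preserves uniform convergence on a compact set to a
continuous limit. -/
theorem tendsto_comp_sub_comp_of_isCompact {S : Set E} (hS : IsCompact S) {y : ℕ → E → W}
    {z : E → W} (hz : Continuous z) {h : E × W → V} (hh : Continuous h)
    (hy : Tendsto (fun p : ℕ × E => ‖y p.1 p.2 - z p.2‖) (atTop ×ˢ 𝓟 S) (𝓝 0)) :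
    Tendsto (fun p : ℕ × E => ‖h (p.2, y p.1 p.2) - h (p.2, z p.2)‖) (atTop ×ˢ 𝓟 S) (𝓝 0) := by
  rw [Metric.tendsto_nhds]
  intro ε hε
  have hK : IsCompact ((fun x => (x, z x)) '' S) := hS.image (by fun_prop)
  obtain ⟨δ, hδ, hδε⟩ := Metric.mem_uniformity_dist.1
    (hK.uniformContinuousAt_of_continuousAt h (fun a _ => hh.continuousAt)
      (Metric.dist_mem_uniformity hε))
  have hmem : ∀ᶠ p : ℕ × E in atTop ×ˢ 𝓟 S, p.2 ∈ S :=
    eventually_prod_principal_iff.2 (Eventually.of_forall fun _ _ hx => hx)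
  filter_upwards [Metric.tendsto_nhds.1 hy δ hδ, hmem] with p hp hpS
  have hd : dist ((p.2, z p.2) : E × W) (p.2, y p.1 p.2) < δ := by
    rw [Prod.dist_eq, dist_self, max_lt_iff, dist_comm, dist_eq_norm]
    simpa [hδ] using hp
  have := hδε hd (mem_image_of_mem _ hpS)
  rw [dist_zero_right, norm_norm, ← dist_eq_norm, dist_comm]
  exact this

variable [NormedSpace ℝ E] [NormedSpace ℝ W] [NormedSpace ℝ V]

/-- If `D` is close to `D'`, then `A ∘ (id, D)` is close to `A' ∘ (id, D')`. -/
theorem norm_comp_prod_sub_comp_prod_le (A A' : E × W →L[ℝ] V) (D D' : E →L[ℝ] W) :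
    ‖A.comp ((ContinuousLinearMap.id ℝ E).prod D)
        - A'.comp ((ContinuousLinearMap.id ℝ E).prod D')‖
      ≤ ‖A‖ * ‖D - D'‖ + ‖A - A'‖ * (1 + ‖D'‖) := by
  have hsplit : A.comp ((ContinuousLinearMap.id ℝ E).prod D)
        - A'.comp ((ContinuousLinearMap.id ℝ E).prod D')
      = A.comp ((0 : E →L[ℝ] E).prod (D - D'))
        + (A - A').comp ((ContinuousLinearMap.id ℝ E).prod D') := by
    ext v
    have : ((v, D v) : E × W) = (0, (D - D') v) + (v, D' v) := by simp
    simp only [sub_apply, add_apply,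
      ContinuousLinearMap.comp_apply, ContinuousLinearMap.prod_apply,
      ContinuousLinearMap.id_apply, zero_apply] at this ⊢
    rw [this, map_add]
    abel
  rw [hsplit]
  refine (norm_add_le _ _).trans (add_le_add ?_ ?_)
  · refine (ContinuousLinearMap.opNorm_comp_le _ _).trans ?_
    gcongr
    rw [ContinuousLinearMap.opNorm_prod]
    simp [Prod.norm_def]
  · refine (ContinuousLinearMap.opNorm_comp_le _ _).trans ?_
    gcongr
    rw [ContinuousLinearMap.opNorm_prod, Prod.norm_def]
    refine max_le ?_ ?_
    · exact ContinuousLinearMap.norm_id_le.trans (by simp)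
    · simp

end UniformConvergence

section Iteration

variable {E W V : Type*} [NormedAddCommGroup E] [NormedSpace ℝ E] [NormedAddCommGroup W]
  [NormedSpace ℝ W] [NormedAddCommGroup V] [NormedSpace ℝ V]

/-- A function `w ↦ w - b • g (x, w)` with derivative bounded by `ρ` is `ρ`-Lipschitz. -/
theorem norm_sub_smul_sub_le {g : E × W → W} (hg : Differentiable ℝ g) {b ρ : ℝ} (hρ : 0 ≤ ρ)
    (hcontr : ∀ p v, ‖v - b • fderiv ℝ g p (0, v)‖ ≤ ρ * ‖v‖) (x : E) (v w : W) :
    ‖(v - b • g (x, v)) - (w - b • g (x, w))‖ ≤ ρ * ‖v - w‖ := by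
  have hder : ∀ u : W, HasFDerivAt (fun u => u - b • g (x, u))
      (ContinuousLinearMap.id ℝ W
        - b • (fderiv ℝ g (x, u)).comp (ContinuousLinearMap.inr ℝ E W)) u := fun u =>
    (hasFDerivAt_id u).sub
      (((hg (x, u)).hasFDerivAt.comp u (hasFDerivAt_prodMk_right x u)).const_smul b)
  refine convex_univ.norm_image_sub_le_of_norm_hasFDerivWithin_le
    (f := fun u => u - b • g (x, u)) (fun u _ => (hder u).hasFDerivWithinAt) (fun u _ => ?_)
    (mem_univ w) (mem_univ v)
  exact ContinuousLinearMap.opNorm_le_bound _ hρ fun u' => by simpa using hcontr (x, u) u'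

variable {S : Set E} {g G : E × W → W} {y : ℕ → E → W} {z : E → W} {a b : ℕ → ℝ} {ρ L M : ℝ}

theorem contDiff_iterate (hg : ContDiff ℝ 1 g) (hG : ContDiff ℝ 1 G) (hy0 : ContDiff ℝ 1 (y 0))
    (hy : ∀ k x, y (k + 1) x = y k x - (a k • G (x, y k x) + b k • g (x, y k x))) (k : ℕ) :
    ContDiff ℝ 1 (y k) := by
  induction k with
  | zero => exact hy0
  | succ k ih =>
    rw [show y (k + 1) = _ from funext (hy k)]
    fun_prop

/-- The iterates converge uniformly on compact sets to the zero of `g`. -/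
theorem tendsto_iterate (hS : IsCompact S) (hg : ContDiff ℝ 1 g) (hG : ContDiff ℝ 1 G)
    (hz : ContDiff ℝ 1 z) (hgz : ∀ x, g (x, z x) = 0) (hρ0 : 0 ≤ ρ) (hρ1 : ρ < 1)
    (hcontr : ∀ k p v, ‖v - b k • fderiv ℝ g p (0, v)‖ ≤ ρ * ‖v‖) (hL : 0 ≤ L)
    (hGL : ∀ x v w, ‖G (x, v) - G (x, w)‖ ≤ L * ‖v - w‖) (ha : Tendsto a atTop (𝓝 0))
    (hy0 : ContDiff ℝ 1 (y 0))
    (hy : ∀ k x, y (k + 1) x = y k x - (a k • G (x, y k x) + b k • g (x, y k x))) :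
    Tendsto (fun p : ℕ × E => ‖y p.1 p.2 - z p.2‖) (atTop ×ˢ 𝓟 S) (𝓝 0) := by
  have hyC : ∀ k, Continuous (y k) := fun k => (contDiff_iterate hg hG hy0 hy k).continuous
  have hzC : Continuous z := hz.continuous
  have hGC : Continuous G := hG.continuous
  obtain ⟨B, hB⟩ := hS.exists_bound_of_continuousOn
    (f := fun x => G (x, z x)) (by fun_prop)
  refine tendsto_zero_of_le_mul_add (e := fun k x => ‖y k x - z x‖)
    (c := fun k _ => |a k| * (B + L)) hρ0 hρ1 (fun _ _ => norm_nonneg _)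
    (fun k => ?_) ?_ fun k x hx => ?_
  · obtain ⟨C, hC⟩ := hS.exists_bound_of_continuousOn
      (f := fun x => y k x - z x) ((hyC k).sub hzC).continuousOn
    exact ⟨C, by rintro _ ⟨x, hx, rfl⟩; exact hC x hx⟩
  · simpa [Function.comp_def] using (ha.abs.mul_const (B + L)).comp (tendsto_fst (g := 𝓟 S))
  · have hsplit : y (k + 1) x - z x
        = ((y k x - b k • g (x, y k x)) - (z x - b k • g (x, z x))) - a k • G (x, y k x) := by
      rw [hy, hgz, smul_zero, sub_zero]
      abel
    have h1 := norm_sub_smul_sub_le (hg.differentiable one_ne_zero) hρ0 (hcontr k) x (y k x) (z x)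
    have h2 : ‖G (x, y k x)‖ ≤ (B + L) * (1 + ‖y k x - z x‖) := by
      have h3 := norm_le_norm_sub_add (G (x, y k x)) (G (x, z x))
      have h4 := hGL x (y k x) (z x)
      have h5 := hB x hx
      have h6 : 0 ≤ B * ‖y k x - z x‖ :=
        mul_nonneg ((norm_nonneg _).trans h5) (norm_nonneg _)
      linarith
    calc ‖y (k + 1) x - z x‖
        ≤ ‖(y k x - b k • g (x, y k x)) - (z x - b k • g (x, z x))‖ + ‖a k • G (x, y k x)‖ := by
          rw [hsplit]
          exact norm_sub_le _ _
      _ ≤ ρ * ‖y k x - z x‖ + |a k| * ((B + L) * (1 + ‖y k x - z x‖)) := by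
          rw [norm_smul, Real.norm_eq_abs]
          gcongr
      _ = _ := by ring

/-- The derivative of `x ↦ h (x, u x)`. -/
theorem hasFDerivAt_comp_prodMk {h : E × W → V} {u : E → W} (hh : Differentiable ℝ h)
    (hu : Differentiable ℝ u) (x : E) :
    HasFDerivAt (fun x => h (x, u x))
      ((fderiv ℝ h (x, u x)).comp ((ContinuousLinearMap.id ℝ E).prod (fderiv ℝ u x))) x :=
  (hh (x, u x)).hasFDerivAt.comp x ((hasFDerivAt_id x).prodMk (hu x).hasFDerivAt)

/-- The derivatives of the iterates converge uniformly on compact sets to the derivative of the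
zero of `g`. -/
theorem tendsto_fderiv_iterate (hS : IsCompact S) (hg : ContDiff ℝ 1 g) (hG : ContDiff ℝ 1 G)
    (hz : ContDiff ℝ 1 z) (hgz : ∀ x, g (x, z x) = 0) (hρ0 : 0 ≤ ρ) (hρ1 : ρ < 1)
    (hcontr : ∀ k p v, ‖v - b k • fderiv ℝ g p (0, v)‖ ≤ ρ * ‖v‖) (ha : Tendsto a atTop (𝓝 0))
    (hb : ∀ k, |b k| ≤ M) (hy0 : ContDiff ℝ 1 (y 0))
    (hy : ∀ k x, y (k + 1) x = y k x - (a k • G (x, y k x) + b k • g (x, y k x)))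
    (hyz : Tendsto (fun p : ℕ × E => ‖y p.1 p.2 - z p.2‖) (atTop ×ˢ 𝓟 S) (𝓝 0)) :
    Tendsto (fun p : ℕ × E => ‖fderiv ℝ (y p.1) p.2 - fderiv ℝ z p.2‖) (atTop ×ˢ 𝓟 S) (𝓝 0) := by
  have hyD := contDiff_iterate hg hG hy0 hy
  have hzD : Continuous (fderiv ℝ z) := hz.continuous_fderiv one_ne_zero
  have hgD : Continuous (fderiv ℝ g) := hg.continuous_fderiv one_ne_zero
  have hGD : Continuous (fderiv ℝ G) := hG.continuous_fderiv one_ne_zero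
  have hzC : Continuous z := hz.continuous
  obtain ⟨B₀, hB₀⟩ := hS.exists_bound_of_continuousOn hzD.continuousOn
  obtain ⟨B, hB0, hB⟩ : ∃ B, 0 ≤ B ∧ ∀ x ∈ S, ‖fderiv ℝ z x‖ ≤ B :=
    ⟨|B₀|, abs_nonneg _, fun x hx => (hB₀ x hx).trans (le_abs_self _)⟩
  obtain ⟨C, hC⟩ := hS.exists_bound_of_continuousOn
    (f := fun x => fderiv ℝ G (x, z x)) (by fun_prop)
  have hG' := tendsto_comp_sub_comp_of_isCompact hS hzC hGD hyz
  have hg' := tendsto_comp_sub_comp_of_isCompact hS hzC hgD hyz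
  have ha' : Tendsto (fun p : ℕ × E => |a p.1|) (atTop ×ˢ 𝓟 S) (𝓝 0) := by
    simpa [Function.comp_def] using ha.abs.comp (tendsto_fst (g := 𝓟 S))
  refine tendsto_zero_of_le_mul_add (e := fun k x => ‖fderiv ℝ (y k) x - fderiv ℝ z x‖)
    (c := fun k x => M * ‖fderiv ℝ g (x, y k x) - fderiv ℝ g (x, z x)‖ * (1 + B)
      + |a k| * (‖fderiv ℝ G (x, y k x) - fderiv ℝ G (x, z x)‖ + C) * (1 + B))
    hρ0 hρ1 (fun _ _ => norm_nonneg _) (fun k => ?_) ?_ fun k x hx => ?_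
  · obtain ⟨C, hC⟩ := hS.exists_bound_of_continuousOn (f := fun x => fderiv ℝ (y k) x - fderiv ℝ z x)
      (((hyD k).continuous_fderiv one_ne_zero).sub hzD).continuousOn
    exact ⟨C, by rintro _ ⟨x, hx, rfl⟩; exact hC x hx⟩
  · simpa using ((hg'.const_mul M).mul_const (1 + B)).add
      ((ha'.mul (hG'.add_const C)).mul_const (1 + B))
  · set I := ContinuousLinearMap.id ℝ E
    set D := fderiv ℝ (y k) x
    set D' := fderiv ℝ z x
    set A := fderiv ℝ g (x, y k x)
    set A' := fderiv ℝ g (x, z x)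
    set P := fderiv ℝ G (x, y k x)
    set P' := fderiv ℝ G (x, z x)
    have hgd := hg.differentiable one_ne_zero
    have hGd := hG.differentiable one_ne_zero
    have hyd := (hyD k).differentiable one_ne_zero
    have hnext : fderiv ℝ (y (k + 1)) x
        = D - (a k • P.comp (I.prod D) + b k • A.comp (I.prod D)) := by
      rw [show y (k + 1) = _ from funext (hy k)]
      exact ((hyd x).hasFDerivAt.sub (((hasFDerivAt_comp_prodMk hGd hyd x).const_smul (a k)).add
        ((hasFDerivAt_comp_prodMk hgd hyd x).const_smul (b k)))).fderiv
    have hzero : A'.comp (I.prod D') = 0 := by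
      rw [← (hasFDerivAt_comp_prodMk hgd (hz.differentiable one_ne_zero) x).fderiv]
      simp [hgz]
    have hsplit : fderiv ℝ (y (k + 1)) x - D'
        = ((D - D') - b k • A.comp ((0 : E →L[ℝ] E).prod (D - D')))
          - b k • (A - A').comp (I.prod D') - a k • P.comp (I.prod D) := by
      rw [hnext, ContinuousLinearMap.sub_comp, hzero, sub_zero]
      have : I.prod D = (0 : E →L[ℝ] E).prod (D - D') + I.prod D' := by
        ext v <;> simp
      nth_rewrite 2 [this]
      rw [ContinuousLinearMap.comp_add, smul_add]
      abel
    have h1 : ‖(D - D') - b k • A.comp ((0 : E →L[ℝ] E).prod (D - D'))‖ ≤ ρ * ‖D - D'‖ := by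
      refine ContinuousLinearMap.opNorm_le_bound _ (by positivity) fun v => ?_
      refine (hcontr k (x, y k x) ((D - D') v)).trans ?_
      rw [mul_assoc]
      gcongr
      exact ContinuousLinearMap.le_opNorm _ _
    have h2 : ‖(A - A').comp (I.prod D')‖ ≤ ‖A - A'‖ * (1 + B) := by
      have := norm_comp_prod_sub_comp_prod_le (A - A') 0 D' D'
      simp only [ContinuousLinearMap.zero_comp, sub_zero, sub_self, norm_zero, mul_zero,
        zero_add] at this
      refine this.trans ?_
      gcongr
      exact hB x hx
    have h3 : ‖P.comp (I.prod D)‖ ≤ (‖P - P'‖ + C) * ((1 + B) * (1 + ‖D - D'‖)) := by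
      have := norm_comp_prod_sub_comp_prod_le P 0 D D
      simp only [ContinuousLinearMap.zero_comp, sub_zero, sub_self, norm_zero, mul_zero,
        zero_add] at this
      refine this.trans ?_
      have hP : ‖P‖ ≤ ‖P - P'‖ + C := by
        linarith [norm_le_norm_sub_add P P', hC x hx]
      have hD : 1 + ‖D‖ ≤ (1 + B) * (1 + ‖D - D'‖) := by
        nlinarith [norm_le_norm_sub_add D D', hB x hx, norm_nonneg (D - D')]
      exact mul_le_mul hP hD (by positivity) ((norm_nonneg _).trans hP)
    have hM : 0 ≤ M := (abs_nonneg _).trans (hb k)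
    calc ‖fderiv ℝ (y (k + 1)) x - D'‖
        ≤ ‖(D - D') - b k • A.comp ((0 : E →L[ℝ] E).prod (D - D'))‖
          + ‖b k • (A - A').comp (I.prod D')‖ + ‖a k • P.comp (I.prod D)‖ := by
          rw [hsplit]
          exact (norm_sub_le _ _).trans (add_le_add_left (norm_sub_le _ _) _)
      _ ≤ ρ * ‖D - D'‖ + M * (‖A - A'‖ * (1 + B))
          + |a k| * ((‖P - P'‖ + C) * ((1 + B) * (1 + ‖D - D'‖))) := by
          rw [norm_smul, norm_smul, Real.norm_eq_abs, Real.norm_eq_abs]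
          gcongr
          exact hb k
      _ ≤ _ := by
          have : 0 ≤ M * (‖A - A'‖ * (1 + B)) * ‖D - D'‖ := by positivity
          linarith

/-- If `y k → z` together with first derivatives, uniformly on a compact set, then the derivatives
of `x ↦ h (x, y k x)` converge uniformly to that of `x ↦ h (x, z x)`. -/
theorem tendsto_fderiv_comp_prodMk (hS : IsCompact S) {h : E × W → V} (hh : ContDiff ℝ 1 h)
    (hz : ContDiff ℝ 1 z) (hyD : ∀ k, ContDiff ℝ 1 (y k))
    (hyz : Tendsto (fun p : ℕ × E => ‖y p.1 p.2 - z p.2‖) (atTop ×ˢ 𝓟 S) (𝓝 0))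
    (hyz' : Tendsto (fun p : ℕ × E => ‖fderiv ℝ (y p.1) p.2 - fderiv ℝ z p.2‖)
      (atTop ×ˢ 𝓟 S) (𝓝 0)) :
    Tendsto (fun p : ℕ × E => ‖fderiv ℝ (fun x => h (x, y p.1 x)) p.2
      - fderiv ℝ (fun x => h (x, z x)) p.2‖) (atTop ×ˢ 𝓟 S) (𝓝 0) := by
  have hzD : Continuous (fderiv ℝ z) := hz.continuous_fderiv one_ne_zero
  have hhD : Continuous (fderiv ℝ h) := hh.continuous_fderiv one_ne_zero
  have hzC : Continuous z := hz.continuous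
  obtain ⟨B, hB⟩ := hS.exists_bound_of_continuousOn hzD.continuousOn
  obtain ⟨C, hC⟩ := hS.exists_bound_of_continuousOn
    (f := fun x => fderiv ℝ h (x, z x)) (by fun_prop)
  have hh' := tendsto_comp_sub_comp_of_isCompact hS hzC hhD hyz
  have hlim : Tendsto (fun p : ℕ × E =>
      (‖fderiv ℝ h (p.2, y p.1 p.2) - fderiv ℝ h (p.2, z p.2)‖ + C)
        * ‖fderiv ℝ (y p.1) p.2 - fderiv ℝ z p.2‖
      + ‖fderiv ℝ h (p.2, y p.1 p.2) - fderiv ℝ h (p.2, z p.2)‖ * (1 + B))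
      (atTop ×ˢ 𝓟 S) (𝓝 0) := by
    simpa using ((hh'.add_const C).mul hyz').add (hh'.mul_const (1 + B))
  refine tendsto_of_tendsto_of_tendsto_of_le_of_le' tendsto_const_nhds hlim
    (Eventually.of_forall fun _ => norm_nonneg _)
    (eventually_prod_principal_iff.2 (Eventually.of_forall fun k x hx => ?_))
  have hhd := hh.differentiable one_ne_zero
  dsimp only
  rw [(hasFDerivAt_comp_prodMk hhd ((hyD k).differentiable one_ne_zero) x).fderiv,
    (hasFDerivAt_comp_prodMk hhd (hz.differentiable one_ne_zero) x).fderiv]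
  refine (norm_comp_prod_sub_comp_prod_le _ _ _ _).trans ?_
  gcongr
  · linarith [norm_le_norm_sub_add (fderiv ℝ h (x, y k x)) (fderiv ℝ h (x, z x)), hC x hx]
  · exact hB x hx

end Iteration

section QuadraticForm

variable {W : Type*} [NormedAddCommGroup W] [InnerProductSpace ℝ W]

/-- A gradient step along a symmetric operator between `σ` and `L` is a contraction if the step
size `b` satisfies `b₀ ≤ b ≤ 1 / L`. -/
theorem norm_sub_smul_le_of_isSymmetric {A : W →L[ℝ] W} {σ L b b₀ : ℝ} (hσ : 0 ≤ σ)
    (hsymm : ∀ v w, inner ℝ (A v) w = inner ℝ (A w) v)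
    (hlow : ∀ v, σ * ‖v‖ ^ 2 ≤ inner ℝ (A v) v) (hL : 0 < L) (hup : ∀ v, ‖A v‖ ≤ L * ‖v‖)
    (hb0 : 0 ≤ b₀) (hb : b₀ ≤ b) (hbL : b * L ≤ 1) (v : W) :
    ‖v - b • A v‖ ≤ √(1 - b₀ * σ) * ‖v‖ := by
  have hcoco : ‖A v‖ ^ 2 ≤ L * inner ℝ (A v) v := by
    have h1 : 0 ≤ inner ℝ (A (L • v - A v)) (L • v - A v) :=
      (mul_nonneg hσ (sq_nonneg _)).trans (hlow _)
    have h2 : inner ℝ (A (L • v - A v)) (L • v - A v)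
        = L ^ 2 * inner ℝ (A v) v - 2 * L * ‖A v‖ ^ 2 + inner ℝ (A (A v)) (A v) := by
      simp only [map_sub, map_smul, inner_sub_left, inner_sub_right, real_inner_smul_left,
        real_inner_smul_right, hsymm (A v) v, real_inner_self_eq_norm_sq]
      ring
    have h3 : inner ℝ (A (A v)) (A v) ≤ L * ‖A v‖ ^ 2 := by
      refine (real_inner_le_norm _ _).trans ?_
      nlinarith [hup (A v), norm_nonneg (A v)]
    have h4 : 0 ≤ L * (L * inner ℝ (A v) v - ‖A v‖ ^ 2) := by nlinarith
    linarith [nonneg_of_mul_nonneg_right h4 hL]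
  have hsq : ‖v - b • A v‖ ^ 2 ≤ (1 - b₀ * σ) * ‖v‖ ^ 2 := by
    have hexp : ‖v - b • A v‖ ^ 2
        = ‖v‖ ^ 2 - 2 * b * inner ℝ (A v) v + b ^ 2 * ‖A v‖ ^ 2 := by
      rw [norm_sub_sq_real, real_inner_smul_right, norm_smul, mul_pow, Real.norm_eq_abs, sq_abs,
        real_inner_comm]
      ring
    have hb' : 0 ≤ b := hb0.trans hb
    have h0 : 0 ≤ inner ℝ (A v) v := (mul_nonneg hσ (sq_nonneg _)).trans (hlow v)
    have h1 : b ^ 2 * ‖A v‖ ^ 2 ≤ b * inner ℝ (A v) v := by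
      calc b ^ 2 * ‖A v‖ ^ 2 ≤ b ^ 2 * (L * inner ℝ (A v) v) := by gcongr
        _ = (b * L) * (b * inner ℝ (A v) v) := by ring
        _ ≤ 1 * (b * inner ℝ (A v) v) := by gcongr
        _ = _ := one_mul _
    have h2 : b₀ * (σ * ‖v‖ ^ 2) ≤ b * inner ℝ (A v) v :=
      mul_le_mul hb (hlow v) (by positivity) hb'
    rw [hexp]
    linarith
  calc ‖v - b • A v‖ ≤ √((1 - b₀ * σ) * ‖v‖ ^ 2) := Real.le_sqrt_of_sq_le hsq
    _ = _ := by rw [Real.sqrt_mul' _ (sq_nonneg _), Real.sqrt_sq (norm_nonneg _)]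

end QuadraticForm

section PartialGradient

variable {E W : Type*} [NormedAddCommGroup E] [NormedSpace ℝ E] [NormedAddCommGroup W]
  [InnerProductSpace ℝ W] [CompleteSpace W]

/-- The gradient of `h (x, w)` with respect to `w`, as a function of `(x, w)`. -/
noncomputable def partialGradient (h : E × W → ℝ) (p : E × W) : W :=
  (InnerProductSpace.toDual ℝ W).symm ((fderiv ℝ h p).comp (ContinuousLinearMap.inr ℝ E W))

variable {h : E × W → ℝ} {σ L : ℝ}

theorem inner_partialGradient (p : E × W) (v : W) :
    inner ℝ (partialGradient h p) v = fderiv ℝ h p (0, v) := by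
  simp [partialGradient]

theorem gradient_prodMk (hh : Differentiable ℝ h) (x : E) (w : W) :
    gradient (fun w => h (x, w)) w = partialGradient h (x, w) := by
  rw [gradient, partialGradient]
  congr 1
  exact ((hh (x, w)).hasFDerivAt.comp w (hasFDerivAt_prodMk_right x w)).fderiv

theorem contDiff_partialGradient (hh : ContDiff ℝ 2 h) : ContDiff ℝ 1 (partialGradient h) :=
  (InnerProductSpace.toDual ℝ W).symm.contDiff.comp
    ((hh.fderiv_right (m := 1) (by norm_num)).clm_comp contDiff_const)

theorem inner_fderiv_partialGradient (hh : ContDiff ℝ 2 h) (p u : E × W) (v : W) :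
    inner ℝ (fderiv ℝ (partialGradient h) p u) v = fderiv ℝ (fderiv ℝ h) p u (0, v) := by
  have h1 : HasFDerivAt (fun p => inner ℝ (partialGradient h p) v)
      ((innerSL ℝ v).comp (fderiv ℝ (partialGradient h) p)) p := by
    simp_rw [real_inner_comm v]
    exact (innerSL ℝ v).hasFDerivAt.comp p
      ((contDiff_partialGradient hh).differentiable one_ne_zero p).hasFDerivAt
  have h2 : HasFDerivAt (fun p => inner ℝ (partialGradient h p) v)
      ((ContinuousLinearMap.apply ℝ ℝ ((0, v) : E × W)).comp (fderiv ℝ (fderiv ℝ h) p)) p := by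
    simp_rw [inner_partialGradient]
    exact (ContinuousLinearMap.apply ℝ ℝ ((0, v) : E × W)).hasFDerivAt.comp p
      ((hh.fderiv_right (m := 1) (by norm_num)).differentiable one_ne_zero p).hasFDerivAt
  have := congrArg (fun A => A u) (h1.unique h2)
  rw [real_inner_comm]
  simpa using this

theorem inner_fderiv_partialGradient_comm (hh : ContDiff ℝ 2 h) (p : E × W) (v w : W) :
    inner ℝ (fderiv ℝ (partialGradient h) p (0, v)) w
      = inner ℝ (fderiv ℝ (partialGradient h) p (0, w)) v := by
  rw [inner_fderiv_partialGradient hh, inner_fderiv_partialGradient hh]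
  exact hh.contDiffAt.isSymmSndFDerivAt (by simp) _ _

theorem monotone_inner_partialGradient_line (hh : Differentiable ℝ h) {x : E}
    (hconv : ConvexOn ℝ univ (fun w => h (x, w) - σ / 2 * ‖w‖ ^ 2)) (w v : W) :
    Monotone fun t : ℝ =>
      inner ℝ (partialGradient h (x, w + t • v)) v - σ * inner ℝ (w + t • v) v := by
  set u : ℝ → ℝ := fun t => h (x, w + t • v) - σ / 2 * ‖w + t • v‖ ^ 2 with hu
  have hline : ∀ t : ℝ, HasDerivAt (fun t : ℝ => w + t • v) v t := fun t => by
    simpa using ((hasDerivAt_id t).smul_const v).const_add w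
  have hder : ∀ t, HasDerivAt u
      (inner ℝ (partialGradient h (x, w + t • v)) v - σ * inner ℝ (w + t • v) v) t := fun t => by
    have h1 : HasDerivAt (fun t : ℝ => h (x, w + t • v))
        (fderiv ℝ h (x, w + t • v) (0, v)) t :=
      (hh _).hasFDerivAt.comp_hasDerivAt t ((hasDerivAt_const t x).prodMk (hline t))
    rw [inner_partialGradient]
    refine (h1.sub (((hline t).norm_sq).const_mul (σ / 2))).congr_deriv ?_
    ring
  have hcu : ConvexOn ℝ univ u := by
    have := hconv.comp_affineMap (AffineMap.lineMap w (w + v))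
    simpa [hu, Function.comp_def, AffineMap.lineMap_apply, add_comm] using this
  have hmono := hcu.monotoneOn_deriv fun t _ => (hder t).differentiableAt
  rw [show deriv u = _ from funext fun t => (hder t).deriv] at hmono
  exact monotoneOn_univ.1 hmono

/-- The partial gradient of a strongly convex function is strongly monotone. -/
theorem mul_norm_sq_le_inner_partialGradient_sub (hh : Differentiable ℝ h) {x : E}
    (hconv : ConvexOn ℝ univ (fun w => h (x, w) - σ / 2 * ‖w‖ ^ 2)) (v w : W) :
    σ * ‖v - w‖ ^ 2
      ≤ inner ℝ (partialGradient h (x, v) - partialGradient h (x, w)) (v - w) := by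
  have := monotone_inner_partialGradient_line hh hconv w (v - w) zero_le_one
  simp only [zero_smul, add_zero, one_smul, add_sub_cancel] at this
  rw [inner_sub_left, ← real_inner_self_eq_norm_sq, inner_sub_left v w (v - w)]
  linarith

/-- The partial Hessian of a strongly convex function is coercive. -/
theorem mul_norm_sq_le_inner_fderiv_partialGradient (hh : ContDiff ℝ 2 h) {x : E}
    (hconv : ConvexOn ℝ univ (fun w => h (x, w) - σ / 2 * ‖w‖ ^ 2)) (w v : W) :
    σ * ‖v‖ ^ 2 ≤ inner ℝ (fderiv ℝ (partialGradient h) (x, w) (0, v)) v := by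
  have hmono := monotone_inner_partialGradient_line (hh.differentiable two_ne_zero) hconv w v
  have hline : HasDerivAt (fun t : ℝ => w + t • v) v 0 := by
    simpa using ((hasDerivAt_id (0 : ℝ)).smul_const v).const_add w
  have hg : HasDerivAt (fun t : ℝ => partialGradient h (x, w + t • v))
      (fderiv ℝ (partialGradient h) (x, w) (0, v)) 0 := by
    have := ((contDiff_partialGradient hh).differentiable one_ne_zero
      (x, w + (0 : ℝ) • v)).hasFDerivAt.comp_hasDerivAt (0 : ℝ)
      ((hasDerivAt_const (0 : ℝ) x).prodMk hline)
    simpa [Function.comp_def] using this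
  have hder := (hg.inner ℝ (hasDerivAt_const (0 : ℝ) v)).sub
    ((hline.inner ℝ (hasDerivAt_const (0 : ℝ) v)).const_mul σ)
  have hnn := hmono.deriv_nonneg (x := 0)
  replace hnn := hnn.trans_eq hder.deriv
  simp only [inner_zero_right, zero_add, real_inner_self_eq_norm_sq] at hnn
  linarith

theorem norm_fderiv_partialGradient_le (hh : ContDiff ℝ 2 h) (hL : 0 ≤ L) {x : E}
    (hlip : ∀ v w, ‖partialGradient h (x, v) - partialGradient h (x, w)‖ ≤ L * ‖v - w‖) (w v : W) :
    ‖fderiv ℝ (partialGradient h) (x, w) (0, v)‖ ≤ L * ‖v‖ := by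
  have hd := ((contDiff_partialGradient hh).differentiable one_ne_zero (x, w)).hasFDerivAt.comp w
    (hasFDerivAt_prodMk_right x w)
  have := hd.le_of_lip' hL (Eventually.of_forall fun v => hlip v w)
  exact ContinuousLinearMap.le_of_opNorm_le _ this v

/-- The minimizer of a strongly convex function depends `C¹` on the parameter. -/
theorem contDiff_argmin [CompleteSpace E] [FiniteDimensional ℝ W] (hh : ContDiff ℝ 2 h)
    (hσ : 0 < σ) (hconv : ∀ x, ConvexOn ℝ univ (fun w => h (x, w) - σ / 2 * ‖w‖ ^ 2))
    {z : E → W} (hz : ∀ x, partialGradient h (x, z x) = 0) : ContDiff ℝ 1 z := by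
  refine contDiff_iff_contDiffAt.2 fun x => ?_
  have hg := (contDiff_partialGradient hh).contDiffAt (x := (x, z x))
  set A := (fderiv ℝ (partialGradient h) (x, z x)).comp (ContinuousLinearMap.inr ℝ E W)
  have hinj : Function.Injective (A : W →ₗ[ℝ] W) := by
    refine (injective_iff_map_eq_zero _).2 fun v hv => ?_
    have h1 := mul_norm_sq_le_inner_fderiv_partialGradient hh (hconv x) (z x) v
    have hv' : fderiv ℝ (partialGradient h) (x, z x) (0, v) = 0 := hv
    rw [hv', inner_zero_left] at h1
    have h2 : ‖v‖ ^ 2 ≤ 0 := nonpos_of_mul_nonpos_right h1 hσ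
    exact norm_eq_zero.1 (pow_eq_zero_iff two_ne_zero |>.1 (le_antisymm h2 (sq_nonneg _)))
  have hinv : A.IsInvertible :=
    ⟨(LinearEquiv.ofInjectiveEndo (A : W →ₗ[ℝ] W) hinj).toContinuousLinearEquiv, by ext; rfl⟩
  refine (hg.contDiffAt_implicitFunction one_ne_zero hinv).congr_of_eventuallyEq ?_
  filter_upwards [hg.eventually_apply_implicitFunction one_ne_zero hinv] with x' hx'
  have h1 := mul_norm_sq_le_inner_partialGradient_sub (hh.differentiable two_ne_zero)
    (hconv x') (z x') (hg.implicitFunction one_ne_zero hinv x')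
  rw [hx', hz, hz, sub_zero, inner_zero_left] at h1
  have h2 := nonpos_of_mul_nonpos_right h1 hσ
  exact sub_eq_zero.1
    (norm_eq_zero.1 (pow_eq_zero_iff two_ne_zero |>.1 (le_antisymm h2 (sq_nonneg _))))

end PartialGradient

theorem stmt11 {n m : ℕ}
    (X : Set (EuclideanSpace ℝ (Fin n))) (hX : IsCompact X)
    (F f : EuclideanSpace ℝ (Fin n) → EuclideanSpace ℝ (Fin m) → ℝ)
    (hF2 : ContDiff ℝ 2 (fun p : EuclideanSpace ℝ (Fin n) × EuclideanSpace ℝ (Fin m) => F p.1 p.2))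
    (hf2 : ContDiff ℝ 2 (fun p : EuclideanSpace ℝ (Fin n) × EuclideanSpace ℝ (Fin m) => f p.1 p.2))
    (LF Lf σ : ℝ) (hσ : 0 < σ)
    (hFconv : ∀ x, ConvexOn ℝ univ (F x))
    (hFlip : ∀ x a b, ‖gradient (F x) a - gradient (F x) b‖ ≤ LF * ‖a - b‖)
    (hFbdd : ∀ x, BddBelow (Set.range (F x)))
    (hfstrong : ∀ x, ConvexOn ℝ univ (fun w => f x w - σ / 2 * ‖w‖ ^ 2))
    (hflip : ∀ x a b, ‖gradient (f x) a - gradient (f x) b‖ ≤ Lf * ‖a - b‖)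
    -- f is level-bounded in y uniformly in x ∈ X
    (hlevel : ∀ r : ℝ, Bornology.IsBounded {w : EuclideanSpace ℝ (Fin m) | ∃ x ∈ X, f x w ≤ r})
    -- y*(x) : the unique minimizer of f(x,·)
    (ystar : EuclideanSpace ℝ (Fin n) → EuclideanSpace ℝ (Fin m))
    (hystar : ∀ x w, f x (ystar x) ≤ f x w)
    (hystaruniq : ∀ x w, (∀ w', f x w ≤ f x w') → w = ystar x)
    (s μ : ℝ) (hs : s ∈ Ioo 0 (1 / max LF Lf)) (hμ : μ ∈ Ioo (0 : ℝ) 1)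
    (α : ℕ → ℝ) (hαpos : ∀ k, 0 < α k) (hαanti : Antitone α) (hαto : Tendsto α atTop (𝓝 0))
    (βlow cβ : ℝ) (hβlow : 0 < βlow) (hcβ : 0 < cβ)
    (β : ℕ → ℝ) (hβ : ∀ k, β k ∈ Icc βlow 1) (hβanti : Antitone β)
    (hβdiff : ∀ k ≥ 1, |β k - β (k - 1)| ≤ cβ / ((k : ℝ) + 1) ^ 2)
    (y₀ : EuclideanSpace ℝ (Fin m))
    (y : ℕ → EuclideanSpace ℝ (Fin n) → EuclideanSpace ℝ (Fin m))
    (hy0 : ∀ x, y 0 x = y₀)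
    (hyrec : ∀ k x, y (k + 1) x =
      y k x - ((α k * μ * s) • gradient (F x) (y k x)
             + (β k * (1 - μ) * s) • gradient (f x) (y k x))) :
    ∀ ε > (0 : ℝ), ∃ N : ℕ, ∀ k ≥ N, ∀ x ∈ X,
      ‖gradient (fun x' => F x' (y k x')) x - gradient (fun x' => F x' (ystar x')) x‖ ≤ ε := by
  obtain ⟨hs0, hsL⟩ := hs
  obtain ⟨hμ0, hμ1⟩ := hμ
  set Φ : EuclideanSpace ℝ (Fin n) × EuclideanSpace ℝ (Fin m) → ℝ := fun p => F p.1 p.2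
  set φ : EuclideanSpace ℝ (Fin n) × EuclideanSpace ℝ (Fin m) → ℝ := fun p => f p.1 p.2
  have hgradF : ∀ x w, gradient (F x) w = partialGradient Φ (x, w) :=
    gradient_prodMk (hF2.differentiable two_ne_zero)
  have hgradf : ∀ x w, gradient (f x) w = partialGradient φ (x, w) :=
    gradient_prodMk (hf2.differentiable two_ne_zero)
  simp only [hgradF, hgradf] at hFlip hflip hyrec
  have hL : 0 < max LF Lf := one_div_pos.1 (hs0.trans hsL)
  set L := max LF Lf
  have hsL1 : s * L ≤ 1 := ((lt_div_iff₀ hL).1 hsL).le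
  have hFlipL : ∀ x v w, ‖partialGradient Φ (x, v) - partialGradient Φ (x, w)‖ ≤ L * ‖v - w‖ :=
    fun x v w => (hFlip x v w).trans (by gcongr; exact le_max_left _ _)
  have hflipL : ∀ x v w, ‖partialGradient φ (x, v) - partialGradient φ (x, w)‖ ≤ L * ‖v - w‖ :=
    fun x v w => (hflip x v w).trans (by gcongr; exact le_max_right _ _)
  have hzero : ∀ x, partialGradient φ (x, ystar x) = 0 := fun x => by
    have hmin : IsLocalMin (f x) (ystar x) := Eventually.of_forall (hystar x)
    rw [← hgradf, gradient, hmin.fderiv_eq_zero, map_zero]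
  have hG := contDiff_partialGradient hF2
  have hg := contDiff_partialGradient hf2
  have hz : ContDiff ℝ 1 ystar := contDiff_argmin hf2 hσ hfstrong hzero
  have hstep : ∀ k, βlow * (1 - μ) * s ≤ β k * (1 - μ) * s ∧ β k * (1 - μ) * s ≤ s := fun k => by
    have h1 : 0 < 1 - μ := by linarith
    refine ⟨by gcongr; exact (hβ k).1, ?_⟩
    have : β k * (1 - μ) ≤ 1 := by nlinarith [(hβ k).1, (hβ k).2]
    nlinarith
  have hlow : 0 < βlow * (1 - μ) * s := mul_pos (mul_pos hβlow (by linarith)) hs0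
  have hρ1 : √(1 - βlow * (1 - μ) * s * σ) < 1 := by
    rw [Real.sqrt_lt' one_pos]
    nlinarith [mul_pos hlow hσ]
  have hcontr : ∀ k p v, ‖v - (β k * (1 - μ) * s) • fderiv ℝ (partialGradient φ) p (0, v)‖
      ≤ √(1 - βlow * (1 - μ) * s * σ) * ‖v‖ := fun k p v =>
    norm_sub_smul_le_of_isSymmetric
      (A := (fderiv ℝ (partialGradient φ) p).comp (ContinuousLinearMap.inr ℝ _ _)) hσ.le
      (inner_fderiv_partialGradient_comm hf2 p)
      (mul_norm_sq_le_inner_fderiv_partialGradient hf2 (hfstrong p.1) p.2) hL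
      (norm_fderiv_partialGradient_le hf2 hL.le (hflipL p.1) p.2) hlow.le (hstep k).1
      ((mul_le_mul_of_nonneg_right (hstep k).2 hL.le).trans hsL1) v
  have ha : Tendsto (fun k => α k * μ * s) atTop (𝓝 0) := by
    simpa using (hαto.mul_const μ).mul_const s
  have hyC0 : ContDiff ℝ 1 (y 0) := by
    rw [show y 0 = fun _ => y₀ from funext hy0]
    exact contDiff_const
  have hlim := tendsto_iterate hX hg hG hz hzero (Real.sqrt_nonneg _) hρ1 hcontr hL.le hFlipL ha
    hyC0 hyrec
  have hlim' := tendsto_fderiv_iterate hX hg hG hz hzero (Real.sqrt_nonneg _) hρ1 hcontr ha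
    (fun k => (abs_of_nonneg (hlow.le.trans (hstep k).1)).trans_le (hstep k).2) hyC0 hyrec hlim
  have hfinal := tendsto_fderiv_comp_prodMk hX (hF2.of_le one_le_two) hz
    (contDiff_iterate hg hG hyC0 hyrec) hlim hlim'
  intro ε hε
  obtain ⟨N, hN⟩ := eventually_atTop.1
    (eventually_prod_principal_iff.1 ((tendsto_order.1 hfinal).2 ε hε))
  refine ⟨N, fun k hk x hx => ?_⟩
  rw [gradient, gradient, ← map_sub, LinearIsometryEquiv.norm_map]
  exact (hN k hk x hx).le
end

section
/- Let X ⊆ ℝⁿ be compact, and let F, f : ℝⁿ × ℝᵐ → ℝ be twice continuously differentiable with: for every x, F(x,·) convex, L_F-smooth and bounded below, and f(x,·) σ-strongly convex (σ > 0) and L_f-smooth; assume f is level-bounded in y uniformly in x ∈ X (for every r ∈ ℝ the set { y : ∃ x ∈ X, f(x,y) ≤ r } is bounded). Let y*(x) denote the unique minimizer of f(x,·); by the implicit function theorem y* is continuously differentiable with Jacobian ∂y*(x)/∂x = −(∇²_{yy} f(x, y*(x)))⁻¹ ∇²_{yx} f(x, y*(x)). Define y_{k+1}(x) = y_k(x)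 − s( α_k μ ∇_y F(x, y_k(x)) + β_k (1−μ) ∇_y f(x, y_k(x)) ), y₀(x) = y₀, with s ∈ (0, 1/max(L_F, L_f)), μ ∈ (0,1), positive nonincreasing α_k → 0, and nonincreasing β_k ∈ [β̲, 1] (β̲ > 0) with |β_k − β_{k−1}| ≤ c_β/(k+1)²; each y_k is differentiable in x. Then sup_{x∈X} ‖ ∂y_k(x)/∂x − ∂y*(x)/∂x ‖ → 0 as k → ∞ (operator norm). -/
open Filter Topology Set Metric

section Hilbert

variable {W : Type*} [NormedAddCommGroup W] [InnerProductSpace ℝ W]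

theorem ConvexOn.inner_gradient_sub_nonneg [CompleteSpace W] {φ : W → ℝ}
    (hc : ConvexOn ℝ univ φ) (hd : Differentiable ℝ φ) (a b : W) :
    0 ≤ inner ℝ (gradient φ a - gradient φ b) (a - b) := by
  have hg : ConvexOn ℝ univ (φ ∘ AffineMap.lineMap (k := ℝ) b a) := hc.comp_affineMap _
  have hder (t : ℝ) : HasDerivAt (φ ∘ AffineMap.lineMap (k := ℝ) b a)
      (inner ℝ (gradient φ (AffineMap.lineMap (k := ℝ) b a t)) (a - b)) t := by
    rw [inner_gradient_left]
    exact (hd _).hasFDerivAt.comp_hasDerivAt t AffineMap.hasDerivAt_lineMap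
  have h₀ := hg.le_slope_of_hasDerivAt (mem_univ 0) (mem_univ 1) one_pos (hder 0)
  have h₁ := hg.slope_le_of_hasDerivAt (mem_univ 0) (mem_univ 1) one_pos (hder 1)
  simp only [AffineMap.lineMap_apply_zero, AffineMap.lineMap_apply_one] at h₀ h₁
  rw [inner_sub_left]
  linarith

theorem inner_gradient_sub_ge_of_strongConvex [CompleteSpace W] {φ : W → ℝ} {σ : ℝ}
    (hc : ConvexOn ℝ univ fun w => φ w - σ / 2 * ‖w‖ ^ 2)
    (hd : Differentiable ℝ φ) (a b : W) :
    σ * ‖a - b‖ ^ 2 ≤ inner ℝ (gradient φ a - gradient φ b) (a - b) := by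
  have hgrad (w : W) : HasGradientAt (fun w => φ w - σ / 2 * ‖w‖ ^ 2)
      (gradient φ w - σ • w) w := by
    rw [hasGradientAt_iff_hasFDerivAt]
    refine ((hd w).hasFDerivAt.sub
      ((hasStrictFDerivAt_norm_sq w).hasFDerivAt.const_mul (σ / 2))).congr_fderiv ?_
    ext v
    simp
    ring
  have h := hc.inner_gradient_sub_nonneg (fun w => (hgrad w).differentiableAt) a b
  rw [(hgrad a).gradient, (hgrad b).gradient,
    show gradient φ a - σ • a - (gradient φ b - σ • b)
      = gradient φ a - gradient φ b - σ • (a - b) by rw [smul_sub]; abel,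
    inner_sub_left, inner_smul_left, real_inner_self_eq_norm_sq] at h
  simpa using h

theorem le_inner_hasFDerivAt_of_strongMono {G : W → W} {H : W →L[ℝ] W} {y : W} {σ : ℝ}
    (hG : HasFDerivAt G H y)
    (hmono : ∀ a b, σ * ‖a - b‖ ^ 2 ≤ inner ℝ (G a - G b) (a - b)) (v : W) :
    σ * ‖v‖ ^ 2 ≤ inner ℝ (H v) v := by
  have hline : HasDerivAt (fun t : ℝ => y + t • v) v 0 := by
    simpa using ((hasDerivAt_id (0 : ℝ)).smul_const v).const_add y
  have hder : HasDerivAt (fun t : ℝ => inner ℝ (G (y + t • v)) v - t * (σ * ‖v‖ ^ 2))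
      (inner ℝ (H v) v - σ * ‖v‖ ^ 2) 0 := by
    have hG' : HasFDerivAt G H (y + (0 : ℝ) • v) := by simpa using hG
    refine (((hG'.comp_hasDerivAt (0 : ℝ) hline).inner ℝ (hasDerivAt_const (0 : ℝ) v)).sub
      ((hasDerivAt_id (0 : ℝ)).mul_const (σ * ‖v‖ ^ 2))).congr_deriv ?_
    simp
  have hm : Monotone (fun t : ℝ => inner ℝ (G (y + t • v)) v - t * (σ * ‖v‖ ^ 2)) := by
    intro r t hrt
    rcases hrt.eq_or_lt with rfl | hlt
    · exact le_rfl
    have h := hmono (y + t • v) (y + r • v)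
    rw [show y + t • v - (y + r • v) = (t - r) • v by rw [sub_smul]; abel, norm_smul,
      inner_smul_right, inner_sub_left, mul_pow, Real.norm_eq_abs, sq_abs] at h
    have : 0 < t - r := sub_pos.2 hlt
    dsimp only
    nlinarith
  have := hm.deriv_nonneg (x := 0)
  rw [hder.deriv] at this
  linarith

theorem isSymmetric_fderiv_gradient [CompleteSpace W] {φ : W → ℝ} (hφ : ContDiff ℝ 2 φ) (y : W) :
    (fderiv ℝ (gradient φ) y).IsSymmetric := by
  have hd : DifferentiableAt ℝ (fderiv ℝ φ) y :=
    (hφ.fderiv_right (m := 1) le_rfl).differentiable one_ne_zero y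
  have hH (v w : W) : inner ℝ (fderiv ℝ (gradient φ) y v) w = fderiv ℝ (fderiv ℝ φ) y v w := by
    have : HasFDerivAt (gradient φ) _ y :=
      ((InnerProductSpace.toDual ℝ W).symm.toContinuousLinearEquiv.hasFDerivAt).comp y
        hd.hasFDerivAt
    rw [this.fderiv]
    simp
  intro v w
  simp only [ContinuousLinearMap.coe_coe]
  rw [hH, real_inner_comm, hH]
  exact (hφ.contDiffAt.isSymmSndFDerivAt (by simp)) v w

theorem norm_id_sub_smul_sub_smul_le {P Q : W →L[ℝ] W} {L σ a b c : ℝ}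
    (hP : P.IsSymmetric) (hQ : Q.IsSymmetric) (hP₀ : ∀ v, 0 ≤ inner ℝ (P v) v)
    (hQ₀ : ∀ v, σ * ‖v‖ ^ 2 ≤ inner ℝ (Q v) v) (hPL : ‖P‖ ≤ L) (hQL : ‖Q‖ ≤ L) (hσ : 0 ≤ σ)
    (ha : 0 ≤ a) (hc : 0 ≤ c) (hcb : c ≤ b) (hab : (a + b) * L ≤ 1) :
    ‖ContinuousLinearMap.id ℝ W - a • P - b • Q‖ ≤ max 0 (1 - c * σ) := by
  have hsymm : (ContinuousLinearMap.id ℝ W - a • P - b • Q).IsSymmetric := by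
    intro v w
    have h₁ := hP v w
    have h₂ := hQ v w
    simp only [ContinuousLinearMap.coe_coe] at h₁ h₂
    simp [inner_sub_left, inner_sub_right, inner_smul_left, inner_smul_right, h₁, h₂]
  have hle {T : W →L[ℝ] W} (hT : ‖T‖ ≤ L) (v : W) : inner ℝ (T v) v ≤ L * ‖v‖ ^ 2 := by
    calc inner ℝ (T v) v ≤ ‖T v‖ * ‖v‖ := real_inner_le_norm _ _
      _ ≤ L * ‖v‖ * ‖v‖ := by gcongr; exact T.le_of_opNorm_le hT v
      _ = L * ‖v‖ ^ 2 := by ring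
  rw [ContinuousLinearMap.norm_eq_iSup_rayleighQuotient _ hsymm]
  refine ciSup_le fun v => ?_
  have hval : (ContinuousLinearMap.id ℝ W - a • P - b • Q).reApplyInnerSelf v
      = ‖v‖ ^ 2 - a * inner ℝ (P v) v - b * inner ℝ (Q v) v := by
    simp [ContinuousLinearMap.reApplyInnerSelf_apply, inner_sub_left, inner_smul_left]
  rcases eq_or_ne v 0 with rfl | hv
  · simp
  have hv' : 0 < ‖v‖ ^ 2 := by positivity
  have hb := hc.trans hcb
  have h₁ : 0 ≤ a * inner ℝ (P v) v := mul_nonneg ha (hP₀ v)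
  have h₂ : c * (σ * ‖v‖ ^ 2) ≤ b * inner ℝ (Q v) v :=
    mul_le_mul hcb (hQ₀ v) (by positivity) hb
  have h₃ := mul_le_mul_of_nonneg_left (hle hPL v) ha
  have h₄ := mul_le_mul_of_nonneg_left (hle hQL v) hb
  rw [ContinuousLinearMap.rayleighQuotient, hval, abs_of_nonneg]
  · refine le_max_of_le_right ?_
    rw [div_le_iff₀ hv']
    linarith
  · refine div_nonneg ?_ hv'.le
    nlinarith

theorem isInvertible_of_le_inner [CompleteSpace W] {T : W →L[ℝ] W} {σ : ℝ} (hσ : 0 < σ)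
    (hT : ∀ v, σ * ‖v‖ ^ 2 ≤ inner ℝ (T v) v) : T.IsInvertible := by
  have hu : IsUnit T := T.isUnit_of_forall_le_norm_inner_map (c := ⟨σ, hσ.le⟩) hσ fun v =>
    (mul_comm _ _).trans_le ((hT v).trans (le_abs_self _))
  obtain ⟨u, rfl⟩ := hu
  exact ⟨ContinuousLinearEquiv.ofUnit u, rfl⟩

end Hilbert

theorem eventually_forall_le_of_le_mul_add {ι : Type*} {X : Set ι} {e δ : ℕ → ι → ℝ} {ρ : ℝ}
    {K : ℕ} (hρ₀ : 0 ≤ ρ) (hρ₁ : ρ < 1)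
    (hrec : ∀ k ≥ K, ∀ x ∈ X, e (k + 1) x ≤ ρ * e k x + δ k x)
    (hδ : ∀ ε > 0, ∀ᶠ k in atTop, ∀ x ∈ X, δ k x ≤ ε)
    (hbdd : ∀ k, ∃ B, ∀ x ∈ X, e k x ≤ B) :
    ∀ ε > 0, ∀ᶠ k in atTop, ∀ x ∈ X, e k x ≤ ε := by
  intro ε hε
  have hρ : 0 < 1 - ρ := sub_pos.2 hρ₁
  obtain ⟨N, hN⟩ := eventually_atTop.1
    ((hδ ((1 - ρ) * (ε / 2)) (by positivity)).and (eventually_ge_atTop K))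
  obtain ⟨B, hB⟩ := hbdd N
  have hpow (j : ℕ) : ∀ x ∈ X, e (N + j) x ≤ ρ ^ j * B + ε / 2 := by
    induction j with
    | zero => intro x hx; have := hB x hx; simp only [add_zero, pow_zero, one_mul]; linarith
    | succ j ih =>
      intro x hx
      have h₁ := hrec (N + j) (hN (N + j) (by lia)).2 x hx
      have h₂ := (hN (N + j) (by lia)).1 x hx
      have h₃ := mul_le_mul_of_nonneg_left (ih x hx) hρ₀
      rw [← add_assoc, pow_succ]
      linarith
  have hlim : Tendsto (fun j : ℕ => ρ ^ j * B) atTop (𝓝 0) := by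
    simpa using (tendsto_pow_atTop_nhds_zero_of_lt_one hρ₀ hρ₁).mul_const B
  obtain ⟨J, hJ⟩ := eventually_atTop.1 (hlim.eventually_le_const (half_pos hε))
  filter_upwards [eventually_ge_atTop (N + J)] with k hk x hx
  obtain ⟨j, rfl⟩ := Nat.exists_eq_add_of_le (show N ≤ k by lia)
  have := hpow j x hx
  have := hJ j (by lia)
  linarith

section Parametric

variable {E W : Type*} [NormedAddCommGroup E] [NormedSpace ℝ E]

theorem contDiff_gradient_prod [NormedAddCommGroup W] [InnerProductSpace ℝ W] [CompleteSpace W]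
    {f : E → W → ℝ} (hf : ContDiff ℝ 2 fun p : E × W => f p.1 p.2) :
    ContDiff ℝ 1 fun p : E × W => gradient (f p.1) p.2 := by
  have hslice : (fun p : E × W => gradient (f p.1) p.2) = fun p =>
      (InnerProductSpace.toDual ℝ W).symm
        ((fderiv ℝ (fun p : E × W => f p.1 p.2) p).comp (.inr ℝ E W)) := by
    ext1 p
    have : HasFDerivAt ((fun q : E × W => f q.1 q.2) ∘ Prod.mk p.1) _ p.2 :=
      (hf.differentiable two_ne_zero (p.1, p.2)).hasFDerivAt.comp p.2
        (hasFDerivAt_prodMk_right p.1 p.2)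
    exact congrArg _ this.fderiv
  rw [hslice]
  exact (InnerProductSpace.toDual ℝ W).symm.contDiff.comp
    ((hf.fderiv_right (m := 1) le_rfl).clm_comp contDiff_const)

theorem contDiff_of_strongMono [CompleteSpace E] [NormedAddCommGroup W] [InnerProductSpace ℝ W]
    [CompleteSpace W] {G : E × W → W} {z : E → W} {σ : ℝ} (hσ : 0 < σ) (hG : ContDiff ℝ 1 G)
    (hmono : ∀ x a b, σ * ‖a - b‖ ^ 2 ≤ inner ℝ (G (x, a) - G (x, b)) (a - b))
    (hz : ∀ x, G (x, z x) = 0) : ContDiff ℝ 1 z := by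
  refine contDiff_iff_contDiffAt.2 fun x₀ => ?_
  have hinv : (fderiv ℝ G (x₀, z x₀) ∘L .inr ℝ E W).IsInvertible :=
    isInvertible_of_le_inner hσ <| le_inner_hasFDerivAt_of_strongMono
      ((hG.differentiable one_ne_zero _).hasFDerivAt.comp (z x₀)
        (hasFDerivAt_prodMk_right x₀ (z x₀))) (hmono x₀)
  have hat : ContDiffAt ℝ 1 G (x₀, z x₀) := hG.contDiffAt
  refine (hat.contDiffAt_implicitFunction one_ne_zero hinv).congr_of_eventuallyEq ?_
  filter_upwards [hat.eventually_apply_implicitFunction one_ne_zero hinv] with x hx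
  have h := hmono x (z x) (hat.implicitFunction one_ne_zero hinv x)
  rw [hx, hz, hz, sub_self, inner_zero_left] at h
  have hzero : ‖z x - hat.implicitFunction one_ne_zero hinv x‖ ^ 2 = 0 :=
    le_antisymm (nonpos_of_mul_nonpos_right h hσ) (sq_nonneg _)
  exact sub_eq_zero.1 (norm_eq_zero.1 (pow_eq_zero_iff two_ne_zero |>.1 hzero))

theorem eventually_forall_norm_comp_sub_le {E W Z : Type*} [NormedAddCommGroup E]
    [NormedAddCommGroup W] [NormedAddCommGroup Z]
    {X : Set E} (hX : IsCompact X) {Ψ : E × W → Z} (hΨ : Continuous Ψ) {z : E → W}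
    (hz : Continuous z) {y : ℕ → E → W}
    (hy : ∀ ε > 0, ∀ᶠ k in atTop, ∀ x ∈ X, ‖y k x - z x‖ ≤ ε) :
    ∀ ε > 0, ∀ᶠ k in atTop, ∀ x ∈ X, ‖Ψ (x, y k x) - Ψ (x, z x)‖ ≤ ε := by
  intro ε hε
  have hK : IsCompact ((fun x => (x, z x)) '' X) := hX.image (by fun_prop)
  obtain ⟨δ, hδ, h⟩ := Metric.mem_uniformity_dist.1 <|
    hK.uniformContinuousAt_of_continuousAt Ψ (fun _ _ => hΨ.continuousAt)
      (Metric.dist_mem_uniformity hε)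
  filter_upwards [hy (δ / 2) (half_pos hδ)] with k hk x hx
  have hdist : dist (x, z x) (x, y k x) < δ := by
    rw [Prod.dist_eq, dist_self, max_eq_right dist_nonneg, dist_comm, dist_eq_norm]
    exact (hk x hx).trans_lt (half_lt_self hδ)
  have := h hdist (mem_image_of_mem _ hx)
  simp only [mem_ofPred_eq] at this
  rw [← dist_eq_norm, dist_comm]
  exact this.le

variable [NormedAddCommGroup W] [NormedSpace ℝ W]

theorem contDiff_of_descent_recursion {A B : E × W → W} (hA : ContDiff ℝ 1 A)
    (hB : ContDiff ℝ 1 B) {a b : ℕ → ℝ} {y₀ : W} {y : ℕ → E → W} (hy₀ : ∀ x, y 0 x = y₀)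
    (hy : ∀ k x, y (k + 1) x = y k x - (a k • A (x, y k x) + b k • B (x, y k x))) (k : ℕ) :
    ContDiff ℝ 1 (y k) := by
  induction k with
  | zero => rw [funext hy₀]; exact contDiff_const
  | succ k ih => rw [funext (hy k)]; fun_prop

theorem fderiv_of_descent_recursion {A B : E × W → W} (hA : Differentiable ℝ A)
    (hB : Differentiable ℝ B) {a b : ℝ} {u v : E → W} (hu : Differentiable ℝ u)
    (huv : ∀ x, v x = u x - (a • A (x, u x) + b • B (x, u x))) (x : E) :
    fderiv ℝ v x = fderiv ℝ u x -
      (a • (fderiv ℝ A (x, u x)).comp ((ContinuousLinearMap.id ℝ E).prod (fderiv ℝ u x)) +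
        b • (fderiv ℝ B (x, u x)).comp ((ContinuousLinearMap.id ℝ E).prod (fderiv ℝ u x))) := by
  have hpair := (hasFDerivAt_id x).prodMk (hu x).hasFDerivAt
  rw [funext huv]
  exact ((hu x).hasFDerivAt.sub ((((hA (x, u x)).hasFDerivAt.comp x hpair).const_smul a).add
    (((hB (x, u x)).hasFDerivAt.comp x hpair).const_smul b))).fderiv

variable {X : Set E} {A B : E × W → W} {z : E → W} {a b : ℕ → ℝ} {bmax ρ : ℝ} {y₀ : W}
  {y : ℕ → E → W}

theorem descent_recursion_tendsto (hX : IsCompact X) (hA : ContDiff ℝ 1 A) (hB : ContDiff ℝ 1 B)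
    (hz : Continuous z) (hBz : ∀ x, B (x, z x) = 0) (ha : ∀ k, 0 ≤ a k)
    (ha₀ : Tendsto a atTop (𝓝 0)) (hρ₀ : 0 ≤ ρ) (hρ₁ : ρ < 1)
    (hcontr : ∀ᶠ k in atTop, ∀ x w, ‖ContinuousLinearMap.id ℝ W
      - a k • (fderiv ℝ A (x, w)).comp (.inr ℝ E W)
      - b k • (fderiv ℝ B (x, w)).comp (.inr ℝ E W)‖ ≤ ρ)
    (hy₀ : ∀ x, y 0 x = y₀)
    (hy : ∀ k x, y (k + 1) x = y k x - (a k • A (x, y k x) + b k • B (x, y k x))) :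
    ∀ ε > 0, ∀ᶠ k in atTop, ∀ x ∈ X, ‖y k x - z x‖ ≤ ε := by
  have hyC := contDiff_of_descent_recursion hA hB hy₀ hy
  obtain ⟨M, hM⟩ := hX.exists_bound_of_continuousOn
    (f := fun x => A (x, z x)) (hA.continuous.comp (by fun_prop)).continuousOn
  obtain ⟨K, hK⟩ := eventually_atTop.1 hcontr
  refine eventually_forall_le_of_le_mul_add (δ := fun k _ => a k * M) hρ₀ hρ₁ (K := K) ?_ ?_ ?_
  · intro k hk x hx
    have hT (w : W) : HasFDerivAt (fun w => w - a k • A (x, w) - b k • B (x, w))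
        (ContinuousLinearMap.id ℝ W - a k • (fderiv ℝ A (x, w)).comp (.inr ℝ E W)
          - b k • (fderiv ℝ B (x, w)).comp (.inr ℝ E W)) w :=
      ((hasFDerivAt_id w).sub (((hA.differentiable one_ne_zero _).hasFDerivAt.comp w
        (hasFDerivAt_prodMk_right x w)).const_smul (a k))).sub
        (((hB.differentiable one_ne_zero _).hasFDerivAt.comp w
        (hasFDerivAt_prodMk_right x w)).const_smul (b k))
    have hlip := convex_univ.norm_image_sub_le_of_norm_hasFDerivWithin_le
      (fun w _ => (hT w).hasFDerivWithinAt) (fun w _ => hK k hk x w)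
      (mem_univ (z x)) (mem_univ (y k x))
    calc ‖y (k + 1) x - z x‖
        = ‖(y k x - a k • A (x, y k x) - b k • B (x, y k x)
            - (z x - a k • A (x, z x) - b k • B (x, z x))) - a k • A (x, z x)‖ := by
          rw [hy, hBz, smul_zero]; congr 1; abel
      _ ≤ ρ * ‖y k x - z x‖ + ‖a k • A (x, z x)‖ := (norm_sub_le _ _).trans (by gcongr)
      _ ≤ ρ * ‖y k x - z x‖ + a k * M := by
          rw [norm_smul, Real.norm_of_nonneg (ha k)]
          have := ha k
          gcongr
          exact hM x hx
  · intro ε hε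
    have : Tendsto (fun k => a k * M) atTop (𝓝 0) := by simpa using ha₀.mul_const M
    filter_upwards [this.eventually_le_const hε] with k hk x _ using hk
  · exact fun k => hX.exists_bound_of_continuousOn ((hyC k).continuous.sub hz).continuousOn

theorem descent_recursion_fderiv_tendsto (hX : IsCompact X) (hA : ContDiff ℝ 1 A)
    (hB : ContDiff ℝ 1 B) (hz : ContDiff ℝ 1 z) (hBz : ∀ x, B (x, z x) = 0)
    (ha : ∀ k, 0 ≤ a k) (ha₀ : Tendsto a atTop (𝓝 0)) (hb : ∀ k, 0 ≤ b k) (hbmax : ∀ k, b k ≤ bmax)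
    (hρ₀ : 0 ≤ ρ) (hρ₁ : ρ < 1)
    (hcontr : ∀ᶠ k in atTop, ∀ x w, ‖ContinuousLinearMap.id ℝ W
      - a k • (fderiv ℝ A (x, w)).comp (.inr ℝ E W)
      - b k • (fderiv ℝ B (x, w)).comp (.inr ℝ E W)‖ ≤ ρ)
    (hy₀ : ∀ x, y 0 x = y₀)
    (hy : ∀ k x, y (k + 1) x = y k x - (a k • A (x, y k x) + b k • B (x, y k x))) :
    ∀ ε > 0, ∀ᶠ k in atTop, ∀ x ∈ X, ‖fderiv ℝ (y k) x - fderiv ℝ z x‖ ≤ ε := by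
  have hyC := contDiff_of_descent_recursion hA hB hy₀ hy
  have hconv := descent_recursion_tendsto hX hA hB hz.continuous hBz ha ha₀ hρ₀ hρ₁ hcontr hy₀ hy
  set J : E → E →L[ℝ] E × W := fun x => (ContinuousLinearMap.id ℝ E).prod (fderiv ℝ z x) with hJ
  have hz' : Continuous (fderiv ℝ z) := hz.continuous_fderiv one_ne_zero
  have hJc : Continuous J := by
    exact (ContinuousLinearMap.prodₗᵢ ℝ).continuous.comp (continuous_const.prodMk hz')
  have hAc : Continuous (fderiv ℝ A) := hA.continuous_fderiv one_ne_zero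
  have hBc : Continuous (fderiv ℝ B) := hB.continuous_fderiv one_ne_zero
  have hBJ (x : E) : (fderiv ℝ B (x, z x)).comp (J x) = 0 := by
    have h : HasFDerivAt (fun x => B (x, z x)) _ x :=
      (hB.differentiable one_ne_zero (x, z x)).hasFDerivAt.comp x
        ((hasFDerivAt_id x).prodMk (hz.differentiable one_ne_zero x).hasFDerivAt)
    rw [funext hBz] at h
    exact h.unique (hasFDerivAt_const _ _)
  obtain ⟨M, hM⟩ := hX.exists_bound_of_continuousOn
    (f := fun x => fderiv ℝ A (x, z x))
    (hAc.comp (continuous_id.prodMk hz.continuous)).continuousOn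
  obtain ⟨C, hC⟩ := hX.exists_bound_of_continuousOn hJc.continuousOn
  obtain ⟨K, hK⟩ := eventually_atTop.1 hcontr
  refine eventually_forall_le_of_le_mul_add
    (δ := fun k x => a k * ‖(fderiv ℝ A (x, y k x)).comp (J x)‖ +
      b k * ‖(fderiv ℝ B (x, y k x)).comp (J x)‖) hρ₀ hρ₁ (K := K) ?_ ?_ ?_
  · intro k hk x hx
    have hsplit : fderiv ℝ (y (k + 1)) x - fderiv ℝ z x =
        (ContinuousLinearMap.id ℝ W - a k • (fderiv ℝ A (x, y k x)).comp (.inr ℝ E W)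
          - b k • (fderiv ℝ B (x, y k x)).comp (.inr ℝ E W)).comp
            (fderiv ℝ (y k) x - fderiv ℝ z x)
        - (a k • (fderiv ℝ A (x, y k x)).comp (J x)
          + b k • (fderiv ℝ B (x, y k x)).comp (J x)) := by
      rw [fderiv_of_descent_recursion (hA.differentiable one_ne_zero)
        (hB.differentiable one_ne_zero) ((hyC k).differentiable one_ne_zero) (hy k)]
      ext1 v
      have hpair : ((v, fderiv ℝ (y k) x v) : E × W)
          = (0, fderiv ℝ (y k) x v - fderiv ℝ z x v) + (v, fderiv ℝ z x v) := by simp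
      simp only [hJ, sub_apply, add_apply, smul_apply, ContinuousLinearMap.comp_apply,
        ContinuousLinearMap.prod_apply, ContinuousLinearMap.id_apply,
        ContinuousLinearMap.inr_apply]
      rw [hpair, map_add, map_add, smul_add, smul_add]
      abel
    rw [hsplit]
    refine (norm_sub_le _ _).trans (add_le_add ?_ ((norm_add_le _ _).trans_eq ?_))
    · exact (ContinuousLinearMap.opNorm_comp_le _ _).trans (by gcongr; exact hK k hk x _)
    · rw [norm_smul, norm_smul, Real.norm_of_nonneg (ha k), Real.norm_of_nonneg (hb k)]
  · intro ε hε
    have hlimA : Tendsto (fun k => a k * ((M + 1) * C)) atTop (𝓝 0) := by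
      simpa using ha₀.mul_const ((M + 1) * C)
    have hη : 0 < ε / 2 / ((|bmax| + 1) * (|C| + 1)) := by positivity
    filter_upwards [hlimA.eventually_le_const (half_pos hε),
      eventually_forall_norm_comp_sub_le hX hAc hz.continuous hconv 1 one_pos,
      eventually_forall_norm_comp_sub_le hX hBc hz.continuous hconv _ hη] with k h₁ h₂ h₃ x hx
    have hA' : ‖fderiv ℝ A (x, y k x)‖ ≤ M + 1 := by
      have h := norm_le_norm_add_norm_sub' (fderiv ℝ A (x, y k x)) (fderiv ℝ A (x, z x))
      linarith [hM x hx, h₂ x hx]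
    have hterm₁ : a k * ‖(fderiv ℝ A (x, y k x)).comp (J x)‖ ≤ ε / 2 := by
      refine le_trans (mul_le_mul_of_nonneg_left ?_ (ha k)) h₁
      exact (ContinuousLinearMap.opNorm_comp_le _ _).trans
        (mul_le_mul hA' (hC x hx) (norm_nonneg _) ((norm_nonneg _).trans hA'))
    have hterm₂ : b k * ‖(fderiv ℝ B (x, y k x)).comp (J x)‖ ≤ ε / 2 := by
      calc b k * ‖(fderiv ℝ B (x, y k x)).comp (J x)‖
          = b k * ‖(fderiv ℝ B (x, y k x) - fderiv ℝ B (x, z x)).comp (J x)‖ := by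
            rw [ContinuousLinearMap.sub_comp, hBJ, sub_zero]
        _ ≤ (|bmax| + 1) * (ε / 2 / ((|bmax| + 1) * (|C| + 1)) * (|C| + 1)) := by
            have hb' : b k ≤ |bmax| + 1 := by linarith [hbmax k, le_abs_self bmax]
            have hJ' : ‖J x‖ ≤ |C| + 1 := by linarith [hC x hx, le_abs_self C]
            refine mul_le_mul hb' ((ContinuousLinearMap.opNorm_comp_le _ _).trans
              (mul_le_mul (h₃ x hx) hJ' (norm_nonneg _) hη.le)) (norm_nonneg _) (by positivity)
        _ = ε / 2 := by field_simp
    linarith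
  · exact fun k => hX.exists_bound_of_continuousOn
      (((hyC k).continuous_fderiv one_ne_zero).sub hz').continuousOn

end Parametric

theorem stmt18 {n m : ℕ}
    (X : Set (EuclideanSpace ℝ (Fin n))) (hX : IsCompact X)
    (F f : EuclideanSpace ℝ (Fin n) → EuclideanSpace ℝ (Fin m) → ℝ)
    (hF2 : ContDiff ℝ 2 (fun p : EuclideanSpace ℝ (Fin n) × EuclideanSpace ℝ (Fin m) => F p.1 p.2))
    (hf2 : ContDiff ℝ 2 (fun p : EuclideanSpace ℝ (Fin n) × EuclideanSpace ℝ (Fin m) => f p.1 p.2))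
    (LF Lf σ : ℝ) (hσ : 0 < σ)
    (hFconv : ∀ x, ConvexOn ℝ univ (F x))
    (hFlip : ∀ x a b, ‖gradient (F x) a - gradient (F x) b‖ ≤ LF * ‖a - b‖)
    (hFbdd : ∀ x, BddBelow (Set.range (F x)))
    (hfstrong : ∀ x, ConvexOn ℝ univ (fun w => f x w - σ / 2 * ‖w‖ ^ 2))
    (hflip : ∀ x a b, ‖gradient (f x) a - gradient (f x) b‖ ≤ Lf * ‖a - b‖)
    -- f is level-bounded in y uniformly in x ∈ X
    (hlevel : ∀ r : ℝ, Bornology.IsBounded {w : EuclideanSpace ℝ (Fin m) | ∃ x ∈ X, f x w ≤ r})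
    -- y*(x) : the unique minimizer of f(x,·)
    (ystar : EuclideanSpace ℝ (Fin n) → EuclideanSpace ℝ (Fin m))
    (hystar : ∀ x w, f x (ystar x) ≤ f x w)
    (hystaruniq : ∀ x w, (∀ w', f x w ≤ f x w') → w = ystar x)
    (s μ : ℝ) (hs : s ∈ Ioo 0 (1 / max LF Lf)) (hμ : μ ∈ Ioo (0 : ℝ) 1)
    (α : ℕ → ℝ) (hαpos : ∀ k, 0 < α k) (hαanti : Antitone α) (hαto : Tendsto α atTop (𝓝 0))
    (βlow cβ : ℝ) (hβlow : 0 < βlow) (hcβ : 0 < cβ)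
    (β : ℕ → ℝ) (hβ : ∀ k, β k ∈ Icc βlow 1) (hβanti : Antitone β)
    (hβdiff : ∀ k ≥ 1, |β k - β (k - 1)| ≤ cβ / ((k : ℝ) + 1) ^ 2)
    (y₀ : EuclideanSpace ℝ (Fin m))
    (y : ℕ → EuclideanSpace ℝ (Fin n) → EuclideanSpace ℝ (Fin m))
    (hy0 : ∀ x, y 0 x = y₀)
    (hyrec : ∀ k x, y (k + 1) x =
      y k x - ((α k * μ * s) • gradient (F x) (y k x)
             + (β k * (1 - μ) * s) • gradient (f x) (y k x))) :
    Differentiable ℝ ystar ∧ (∀ k, Differentiable ℝ (y k)) ∧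
    (∀ ε > (0 : ℝ), ∃ N : ℕ, ∀ k ≥ N, ∀ x ∈ X,
      ‖fderiv ℝ (y k) x - fderiv ℝ ystar x‖ ≤ ε) := by
  obtain ⟨hs₀, hs₁⟩ := hs
  obtain ⟨hμ₀, hμ₁⟩ := hμ
  have hμ' : 0 < 1 - μ := sub_pos.2 hμ₁
  set L := max LF Lf with hL
  have hLpos : 0 < L := one_div_pos.1 (hs₀.trans hs₁)
  have hsL : s * L ≤ 1 := ((lt_div_iff₀ hLpos).1 hs₁).le
  have hFslice (x) : ContDiff ℝ 2 (F x) := hF2.comp (contDiff_prodMk_right x)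
  have hfslice (x) : ContDiff ℝ 2 (f x) := hf2.comp (contDiff_prodMk_right x)
  have hGF := contDiff_gradient_prod hF2
  have hGf := contDiff_gradient_prod hf2
  have hpartF (x w) : HasFDerivAt (gradient (F x)) _ w :=
    (hGF.differentiable one_ne_zero (x, w)).hasFDerivAt.comp w (hasFDerivAt_prodMk_right x w)
  have hpartf (x w) : HasFDerivAt (gradient (f x)) _ w :=
    (hGf.differentiable one_ne_zero (x, w)).hasFDerivAt.comp w (hasFDerivAt_prodMk_right x w)
  have hmonof (x a b) := inner_gradient_sub_ge_of_strongConvex (hfstrong x)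
    ((hfslice x).differentiable two_ne_zero) a b
  have hmonoF (x a b) := (hFconv x).inner_gradient_sub_nonneg
    ((hFslice x).differentiable two_ne_zero) a b
  have hzero (x) : gradient (f x) (ystar x) = 0 := by
    have : IsLocalMin (f x) (ystar x) := Eventually.of_forall (hystar x)
    rw [gradient, this.fderiv_eq_zero, map_zero]
  have hz : ContDiff ℝ 1 ystar := contDiff_of_strongMono hσ hGf hmonof hzero
  have ha (k) : 0 ≤ α k * μ * s := by have := hαpos k; positivity
  have ha₀ : Tendsto (fun k => α k * μ * s) atTop (𝓝 0) := by
    simpa using (hαto.mul_const μ).mul_const s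
  have hb (k) : βlow * (1 - μ) * s ≤ β k * (1 - μ) * s := by have := (hβ k).1; gcongr
  have hbmax (k) : β k * (1 - μ) * s ≤ 1 * (1 - μ) * s := by have := (hβ k).2; gcongr
  have hc : 0 < βlow * (1 - μ) * s := by positivity
  have hcontr : ∀ᶠ k in atTop, ∀ x w, ‖ContinuousLinearMap.id ℝ _
      - (α k * μ * s) • (fderiv ℝ (fun p : EuclideanSpace ℝ (Fin n) × EuclideanSpace ℝ (Fin m) =>
        gradient (F p.1) p.2) (x, w)).comp (.inr ℝ _ _)
      - (β k * (1 - μ) * s) • (fderiv ℝ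
        (fun p : EuclideanSpace ℝ (Fin n) × EuclideanSpace ℝ (Fin m) =>
        gradient (f p.1) p.2) (x, w)).comp (.inr ℝ _ _)‖
      ≤ max 0 (1 - βlow * (1 - μ) * s * σ) := by
    filter_upwards [hαto.eventually_le_const one_pos] with k hk x w
    refine norm_id_sub_smul_sub_smul_le (L := L) ?_ ?_ ?_ ?_ ?_ ?_ hσ.le (ha k) hc.le (hb k) ?_
    · exact (hpartF x w).fderiv ▸ isSymmetric_fderiv_gradient (hFslice x) w
    · exact (hpartf x w).fderiv ▸ isSymmetric_fderiv_gradient (hfslice x) w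
    · simpa using le_inner_hasFDerivAt_of_strongMono (σ := 0) (hpartF x w)
        (by simpa using hmonoF x)
    · exact le_inner_hasFDerivAt_of_strongMono (hpartf x w) (hmonof x)
    · exact (hpartF x w).le_of_lip' hLpos.le (Eventually.of_forall fun v =>
        (hFlip x v w).trans (by gcongr; exact le_max_left _ _))
    · exact (hpartf x w).le_of_lip' hLpos.le (Eventually.of_forall fun v =>
        (hflip x v w).trans (by gcongr; exact le_max_right _ _))
    · have hsum : α k * μ * s + β k * (1 - μ) * s ≤ s := by
        have h₁ : α k * μ * s ≤ 1 * μ * s := by gcongr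
        linarith [hbmax k]
      exact (mul_le_mul_of_nonneg_right hsum hLpos.le).trans hsL
  refine ⟨hz.differentiable one_ne_zero, fun k =>
    (contDiff_of_descent_recursion hGF hGf hy0 hyrec k).differentiable one_ne_zero,
    fun ε hε => eventually_atTop.1 ?_⟩
  exact descent_recursion_fderiv_tendsto hX hGF hGf hz hzero ha ha₀
    (fun k => hc.le.trans (hb k)) hbmax (le_max_left _ _)
    (max_lt one_pos (sub_lt_self _ (mul_pos hc hσ))) hcontr hy0 hyrec ε hε
end
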